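/- Let h : K → K be a homeomorphism. Then there exists an integer b such that h(x̄) = σ̂^{−b}(x̄) for every folding point x̄ ∈ F (where σ̂^{−b} denotes the b-th iterate of σ̂^{−1} when b ≥ 0 and the |b|-th iterate of σ̂ when b < 0). -/

import Mathlib

open Set Filter Topology Function

noncomputable section

/-- The tent map with slope `s`. -/
def tent (s : ℝ) (x : ℝ) : ℝ := min (s * x) (s * (1 - x))

/-- The ω-limit set of `c` under iteration of `f`. -/
def omegaSet (f : ℝ → ℝ) (c : ℝ) : Set ℝ :=
  {y | ∃ φ : ℕ → ℕ, StrictMono φ ∧ Tendsto (fun k => f^[φ k] c) atTop (𝓝 y)}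

/-- The inverse limit space `K = lim←([0,1], T)`, as a subset of `ℕ → ℝ`. -/
def invLim (s : ℝ) : Set (ℕ → ℝ) :=
  {x | (∀ n, x n ∈ Icc (0 : ℝ) 1) ∧ ∀ n, x n = tent s (x (n + 1))}

/-- The `n`-th coordinate projection `π_n : K → [0,1]`. -/
def proj (s : ℝ) (n : ℕ) (x : invLim s) : ℝ := (x : ℕ → ℝ) n

/-- The inverse shift homeomorphism `σ̂⁻¹(x₀,x₁,…) = (x₁,x₂,…)` as a map `K → K`. -/
def shiftInvFun (s : ℝ) (x : invLim s) : invLim s :=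
  ⟨fun n => (x : ℕ → ℝ) (n + 1), fun n => x.2.1 (n + 1), fun n => x.2.2 (n + 1)⟩

/-- The shift homeomorphism `σ̂(x₀,x₁,…) = (T x₀, x₀, x₁, …)` as a map `K → K`. -/
def shiftFwdFun (s : ℝ) (hs1 : Real.sqrt 2 < s) (hs2 : s < 2) (x : invLim s) : invLim s := by
  refine ⟨fun n => Nat.casesOn n (tent s ((x : ℕ → ℝ) 0)) (fun k => (x : ℕ → ℝ) k), ?_, ?_⟩
  · intro n
    cases n with
    | zero =>
      have hx0 := x.2.1 0
      have hs0 : 0 ≤ s := le_of_lt (lt_of_le_of_lt (Real.sqrt_nonneg 2) hs1)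
      constructor
      · exact le_min (mul_nonneg hs0 hx0.1) (mul_nonneg hs0 (by linarith [hx0.2]))
      · rcases le_total ((x : ℕ → ℝ) 0) (1 / 2) with hc | hc
        · exact le_trans (min_le_left _ _) (by nlinarith [hx0.1, hx0.2])
        · exact le_trans (min_le_right _ _) (by nlinarith [hx0.1, hx0.2])
    | succ k => exact x.2.1 k
  · intro n
    cases n with
    | zero => rfl
    | succ k => exact x.2.2 k

/-- The integer power `σ̂^b` of the shift homeomorphism : for `b ≥ 0` it is the `b`-th iterate
of `σ̂`, and for `b < 0` the `|b|`-th iterate of `σ̂⁻¹`. -/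
def shiftZ (s : ℝ) (hs1 : Real.sqrt 2 < s) (hs2 : s < 2) (b : ℤ) : invLim s → invLim s :=
  if 0 ≤ b then (shiftFwdFun s hs1 hs2)^[b.toNat] else (shiftInvFun s)^[(-b).toNat]

/-- The set `F` of folding points of `K`. -/
def foldingPts (s : ℝ) : Set (invLim s) :=
  {x | ∀ n, proj s n x ∈ omegaSet (tent s) (1 / 2)}

/-- The set `E_p` of `p`-points of `K`. -/
def pPoints (s : ℝ) (p : ℕ) : Set (invLim s) :=
  {x | ∃ n, p < n ∧ proj s n x = 1 / 2}

/-- `A` is an arc with endpoints `a` and `b`. -/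
def IsArcWith {X : Type*} [TopologicalSpace X] (A : Set X) (a b : X) : Prop :=
  ∃ f : unitInterval → X, Topology.IsEmbedding f ∧ range f = A ∧ f 0 = a ∧ f 1 = b

/-- `A` is an arc (a homeomorphic copy of `[0,1]`). -/
def IsArc {X : Type*} [TopologicalSpace X] (A : Set X) : Prop :=
  ∃ a b, IsArcWith A a b

/-- `A` is an arc with endpoints `a`, `b`, possibly degenerate (a single point when `a = b`). -/
def IsArcBtw {X : Type*} [TopologicalSpace X] (A : Set X) (a b : X) : Prop :=
  IsArcWith A a b ∨ (a = b ∧ A = {a})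

/-- `A` is an arc, possibly degenerate (i.e. a single point). -/
def IsArcOrPoint {X : Type*} [TopologicalSpace X] (A : Set X) : Prop :=
  IsArc A ∨ ∃ x, A = {x}

/-- The composant of a point `x`: the union of all proper subcontinua containing `x`. -/
def composant {X : Type*} [TopologicalSpace X] (x : X) : Set X :=
  {y | ∃ A : Set X, IsCompact A ∧ IsConnected A ∧ A ≠ univ ∧ x ∈ A ∧ y ∈ A}

/-- `g` preserves the order along composants: for every composant `C` and every continuous
bijection `φ` from `ℝ` (respectively from `[0,∞)`) onto `C`, the map `φ⁻¹ ∘ g ∘ φ` is strictly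
increasing. -/
def PreservesCompOrder {X : Type*} [TopologicalSpace X] (g : X → X) : Prop :=
  ∀ x : X,
    (∀ φ : ℝ → X, Continuous φ → Injective φ → range φ = composant x →
      ∀ t t' u u' : ℝ, g (φ t) = φ u → g (φ t') = φ u' → t < t' → u < u') ∧
    (∀ φ : {r : ℝ // (0 : ℝ) ≤ r} → X, Continuous φ → Injective φ → range φ = composant x →
      ∀ t t' u u', g (φ t) = φ u → g (φ t') = φ u' → t < t' → u < u')

/-- Two self-maps of `X` are isotopic if there is a continuous `H : X × [0,1] → X` joining them
through homeomorphisms. -/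
def Isotopic {X : Type*} [TopologicalSpace X] (f g : X → X) : Prop :=
  ∃ H : X × unitInterval → X, Continuous H ∧ (∀ x, H (x, 0) = f x) ∧ (∀ x, H (x, 1) = g x) ∧
    ∀ t : unitInterval, IsHomeomorph fun x => H (x, t)

/-- The topological limsup of a sequence of subsets. -/
def setLimsup {X : Type*} [TopologicalSpace X] (D : ℕ → Set X) : Set X :=
  {y | ∃ φ : ℕ → ℕ, StrictMono φ ∧ ∃ z : ℕ → X, (∀ k, z k ∈ D (φ k)) ∧
    Tendsto z atTop (𝓝 y)}

/-- The point `0̄ = (0,0,0,…)` of `K` (an endpoint of `K`). -/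
def zeroPt (s : ℝ) (hs1 : Real.sqrt 2 < s) : invLim s := by
  refine ⟨fun _ => 0, fun n => ⟨le_refl 0, zero_le_one⟩, fun n => ?_⟩
  have hs0 : 0 ≤ s := le_of_lt (lt_of_le_of_lt (Real.sqrt_nonneg 2) hs1)
  simp [tent]
  exact hs0

/-! ### Basic facts on the tent map and the unfolded map of the ray -/

/-- Standing hypotheses : `d` is a lower bound of the distance of the critical orbit to `1/2`. -/
structure Hyp (s d : ℝ) : Prop where
  h1 : 1 < s
  h2 : s < 2
  hsq : 2 < s ^ 2
  hd : 0 < d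
  hrec : ∀ i : ℕ, 1 ≤ i → d ≤ |(tent s)^[i] (1 / 2) - 1 / 2|

lemma tent_eq {s : ℝ} (hs : 0 ≤ s) (x : ℝ) : tent s x = s / 2 - s * |x - 1 / 2| := by
  unfold tent
  rcases le_total x (1 / 2) with h | h
  · rw [abs_of_nonpos (by linarith), min_eq_left (by nlinarith)]; ring
  · rw [abs_of_nonneg (by linarith), min_eq_right (by nlinarith)]; ring

lemma tent_left {s : ℝ} (hs : 0 ≤ s) {x : ℝ} (h : x ≤ 1 / 2) : tent s x = s * x := by
  unfold tent; rw [min_eq_left (by nlinarith)]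

lemma tent_right {s : ℝ} (hs : 0 ≤ s) {x : ℝ} (h : 1 / 2 ≤ x) : tent s x = s * (1 - x) := by
  unfold tent; rw [min_eq_right (by nlinarith)]

lemma tent_lip {s : ℝ} (hs : 0 ≤ s) (x y : ℝ) : |tent s x - tent s y| ≤ s * |x - y| := by
  rw [tent_eq hs, tent_eq hs]
  have h := abs_abs_sub_abs_le_abs_sub (x - 1 / 2) (y - 1 / 2)
  have e : s / 2 - s * |x - 1 / 2| - (s / 2 - s * |y - 1 / 2|)
      = -(s * (|x - 1 / 2| - |y - 1 / 2|)) := by ring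
  rw [e, abs_neg, abs_mul, abs_of_nonneg hs]
  have e2 : x - 1 / 2 - (y - 1 / 2) = x - y := by ring
  rw [e2] at h
  exact mul_le_mul_of_nonneg_left h hs

lemma tent_iter_lip {s : ℝ} (hs : 0 ≤ s) (n : ℕ) (x y : ℝ) :
    |(tent s)^[n] x - (tent s)^[n] y| ≤ s ^ n * |x - y| := by
  induction n with
  | zero => simp
  | succ n ih =>
    rw [iterate_succ_apply', iterate_succ_apply']
    calc _ ≤ s * |(tent s)^[n] x - (tent s)^[n] y| := tent_lip hs _ _
      _ ≤ s * (s ^ n * |x - y|) := mul_le_mul_of_nonneg_left ih hs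
      _ = _ := by ring

/-- The zeroth coordinate of the ray through `0̄`, unfolded. -/
def gf (s t : ℝ) : ℝ :=
  (tent s)^[sInf {k : ℕ | t / s ^ k ≤ 1 / 2}] (t / s ^ (sInf {k : ℕ | t / s ^ k ≤ 1 / 2}))

lemma exists_div_pow_lt {s : ℝ} (h1 : 1 < s) (t : ℝ) {r : ℝ} (hr : 0 < r) :
    ∃ k : ℕ, t / s ^ k < r := by
  obtain ⟨k, hk⟩ := pow_unbounded_of_one_lt (t / r) h1
  refine ⟨k, ?_⟩
  have : 0 < s ^ k := by positivity
  rw [div_lt_iff₀ this]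
  rw [div_lt_iff₀ hr] at hk
  linarith [mul_comm (s ^ k) r]

lemma div_pow_le_succ {s : ℝ} (h1 : 1 < s) {t r : ℝ} (hr : 0 ≤ r) {k : ℕ} (h : t / s ^ k ≤ r) :
    t / s ^ (k + 1) ≤ r := by
  have hp : 0 < s ^ k := by positivity
  have hs : 0 < s := by linarith
  rw [div_le_iff₀ hp] at h
  rw [div_le_iff₀ (by positivity), pow_succ]
  nlinarith [mul_nonneg hr hp.le]

lemma div_pow_le_of_le {s : ℝ} (h1 : 1 < s) {t r : ℝ} (hr : 0 ≤ r) {k l : ℕ} (hkl : k ≤ l)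
    (h : t / s ^ k ≤ r) : t / s ^ l ≤ r := by
  induction l, hkl using Nat.le_induction with
  | base => exact h
  | succ n _ ih => exact div_pow_le_succ h1 hr ih

lemma gf_aux {s : ℝ} (h1 : 1 < s) {t : ℝ} {k l : ℕ} (hkl : k ≤ l) (h : t / s ^ k ≤ 1 / 2) :
    (tent s)^[l] (t / s ^ l) = (tent s)^[k] (t / s ^ k) := by
  induction l, hkl using Nat.le_induction with
  | base => rfl
  | succ n hn ih =>
    rw [iterate_succ_apply, tent_left (by linarith)
      (div_pow_le_of_le h1 (by norm_num) (Nat.le_succ_of_le hn) h), ← ih]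
    congr 1
    have hs : s ≠ 0 := by linarith
    rw [pow_succ]; field_simp

lemma gf_eq {s : ℝ} (h1 : 1 < s) {t : ℝ} {k : ℕ} (h : t / s ^ k ≤ 1 / 2) :
    gf s t = (tent s)^[k] (t / s ^ k) := by
  have hne : {k : ℕ | t / s ^ k ≤ 1 / 2}.Nonempty := ⟨k, h⟩
  have h0 : t / s ^ (sInf {k : ℕ | t / s ^ k ≤ 1 / 2}) ≤ 1 / 2 := Nat.sInf_mem hne
  exact (gf_aux h1 (Nat.sInf_le h) h0).symm

lemma exists_div_pow_le {s : ℝ} (h1 : 1 < s) (t : ℝ) : ∃ k : ℕ, t / s ^ k ≤ 1 / 2 :=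
  let ⟨k, hk⟩ := exists_div_pow_lt h1 t (by norm_num : (0 : ℝ) < 1 / 2)
  ⟨k, hk.le⟩

lemma gf_scale {s : ℝ} (h1 : 1 < s) (t : ℝ) : gf s (s * t) = tent s (gf s t) := by
  obtain ⟨k, hk⟩ := exists_div_pow_le h1 t
  have hs : s ≠ 0 := by linarith
  have e : s * t / s ^ (k + 1) = t / s ^ k := by rw [pow_succ]; field_simp
  rw [gf_eq h1 hk, gf_eq h1 (k := k + 1) (by rw [e]; exact hk), e, iterate_succ_apply']

lemma gf_small {s : ℝ} (h1 : 1 < s) {t : ℝ} (h : t ≤ s / 2) : gf s t = t := by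
  have hs : s ≠ 0 := by linarith
  have h' : t / s ≤ 1 / 2 := by rw [div_le_iff₀ (by linarith)]; linarith
  rw [gf_eq h1 (k := 1) (by simpa using h')]
  simp only [iterate_one, pow_one]
  rw [tent_left (by linarith) h']; field_simp

lemma gf_lip {s : ℝ} (h1 : 1 < s) (x y : ℝ) : |gf s x - gf s y| ≤ |x - y| := by
  obtain ⟨k, hk⟩ := exists_div_pow_le h1 x
  obtain ⟨l, hl⟩ := exists_div_pow_le h1 y
  have hk' := div_pow_le_of_le h1 (by norm_num) (le_max_left k l) hk
  have hl' := div_pow_le_of_le h1 (by norm_num) (le_max_right k l) hl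
  rw [gf_eq h1 hk', gf_eq h1 hl']
  refine (tent_iter_lip (by linarith) _ _ _).trans (le_of_eq ?_)
  have hp : 0 < s ^ (max k l) := by positivity
  rw [← sub_div, abs_div, abs_of_pos hp]; field_simp

lemma gf_cont {s : ℝ} (h1 : 1 < s) : Continuous (gf s) := by
  refine (LipschitzWith.of_dist_le_mul (K := 1) fun x y => ?_).continuous
  simpa [Real.dist_eq] using gf_lip h1 x y

/-- Induction along the ray: from `t / s` to `t`. -/
lemma gf_induct {s : ℝ} (h1 : 1 < s) {P : ℝ → Prop} (h0 : ∀ t, t ≤ 1 / 2 → P t)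
    (hS : ∀ t, P (t / s) → P t) (t : ℝ) : P t := by
  obtain ⟨k, hk⟩ := exists_div_pow_le h1 t
  induction k generalizing t with
  | zero => exact h0 t (by simpa using hk)
  | succ k ih =>
    refine hS t (ih _ ?_)
    rwa [div_div, ← pow_succ']

lemma gf_step {s : ℝ} (h1 : 1 < s) (t : ℝ) : gf s t = tent s (gf s (t / s)) := by
  rw [← gf_scale h1]; congr 1; field_simp

lemma tent_le {s : ℝ} (hs : 0 ≤ s) (x : ℝ) : tent s x ≤ s / 2 := by
  rw [tent_eq hs]; nlinarith [abs_nonneg (x - 1 / 2)]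

lemma gf_le {s : ℝ} (h1 : 1 < s) (t : ℝ) : gf s t ≤ s / 2 := by
  rw [gf_step h1]; exact tent_le (by linarith) _

lemma gf_nonneg {s : ℝ} (h1 : 1 < s) (h2 : s < 2) (t : ℝ) : 0 ≤ t → 0 ≤ gf s t := by
  refine gf_induct h1 (P := fun t => 0 ≤ t → 0 ≤ gf s t) ?_ ?_ t
  · intro t ht h; rw [gf_small h1 (by linarith)]; exact h
  · intro t ih h
    have := ih (by positivity)
    have h' := gf_le h1 (t / s)
    rw [gf_step h1]
    exact le_min (by nlinarith) (by nlinarith)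

lemma gf_core {s : ℝ} (h1 : 1 < s) (h2 : s < 2) (t : ℝ) :
    s * (1 - s / 2) ≤ t → s * (1 - s / 2) ≤ gf s t := by
  refine gf_induct h1 (P := fun t => s * (1 - s / 2) ≤ t → s * (1 - s / 2) ≤ gf s t) ?_ ?_ t
  · intro t ht h; rw [gf_small h1 (by linarith)]; exact h
  · intro t ih h
    have hc : s * (1 - s / 2) ≤ 1 / 2 := by nlinarith [sq_nonneg (s - 1)]
    have hc0 : 0 < s * (1 - s / 2) := mul_pos (by linarith) (by linarith)
    rcases le_total t (s / 2) with h' | h'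
    · rw [gf_small h1 h']; exact h
    · have := ih (by rw [le_div_iff₀ (by linarith)]; nlinarith)
      have hle := gf_le h1 (t / s)
      rw [gf_step h1]
      exact le_min (by nlinarith) (by nlinarith)

lemma gf_zero {s : ℝ} (h1 : 1 < s) : gf s 0 = 0 := gf_small h1 (by linarith)

lemma gf_le_self {s : ℝ} (h1 : 1 < s) {t : ℝ} (ht : 0 ≤ t) : gf s t ≤ t := by
  have h := gf_lip h1 t 0
  rw [gf_zero h1, sub_zero, sub_zero, abs_of_nonneg ht] at h
  exact (le_abs_self _).trans h

/-- The `n`-th coordinate of the ray. -/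
def GG (s : ℝ) (n : ℕ) (t : ℝ) : ℝ := gf s (t / s ^ n)

lemma GG_zero (s t : ℝ) : GG s 0 t = gf s t := by simp [GG]

lemma GG_succ {s : ℝ} (h1 : 1 < s) (n : ℕ) (t : ℝ) : GG s n t = tent s (GG s (n + 1) t) := by
  unfold GG
  rw [gf_step h1, div_div, ← pow_succ]

lemma GG_iter {s : ℝ} (h1 : 1 < s) (n j : ℕ) (t : ℝ) :
    GG s n t = (tent s)^[j] (GG s (n + j) t) := by
  induction j with
  | zero => rfl
  | succ j ih => rw [iterate_succ_apply, ← add_assoc, ← GG_succ h1, ih]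

lemma GG_lip {s : ℝ} (h1 : 1 < s) (n : ℕ) (x y : ℝ) :
    |GG s n x - GG s n y| ≤ |x - y| / s ^ n := by
  refine (gf_lip h1 _ _).trans (le_of_eq ?_)
  have hp : 0 < s ^ n := by positivity
  rw [← sub_div, abs_div, abs_of_pos hp]

lemma GG_lip' {s : ℝ} (h1 : 1 < s) (n : ℕ) (x y : ℝ) :
    |GG s n x - GG s n y| ≤ |x - y| :=
  (GG_lip h1 n x y).trans (div_le_self (abs_nonneg _) (one_le_pow₀ h1.le))

lemma GG_cont {s : ℝ} (h1 : 1 < s) (n : ℕ) : Continuous (GG s n) :=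
  (gf_cont h1).comp (continuous_id.div_const _)

namespace Hyp
variable {s d : ℝ}

lemma s0 (H : Hyp s d) : 0 < s := by linarith [H.h1]

lemma d_le (H : Hyp s d) : d ≤ (s - 1) / 2 := by
  have h := H.hrec 1 le_rfl
  rw [iterate_one, tent_left H.s0.le le_rfl, abs_of_nonneg (by linarith [H.h1])] at h
  linarith

/-- The basic dichotomy: on an interval the map `gf` is affine, or its image is not small and
contains a point of the critical orbit. -/
lemma dich (H : Hyp s d) (y : ℝ) : ∀ x, x ≤ y →
    (∃ σ e : ℝ, |σ| = 1 ∧ ∀ t ∈ Icc x y, gf s t = σ * t + e) ∨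
    ((∃ i : ℕ, 1 ≤ i ∧ ∃ u ∈ Icc x y, gf s u = (tent s)^[i] (1 / 2)) ∧
      ∃ v ∈ Icc x y, ∃ v' ∈ Icc x y, min ((y - x) / 2) d ≤ |gf s v - gf s v'|) := by
  have h1 := H.h1
  have hs := H.s0
  refine gf_induct h1 (P := fun y => ∀ x, x ≤ y →
    (∃ σ e : ℝ, |σ| = 1 ∧ ∀ t ∈ Icc x y, gf s t = σ * t + e) ∨
    ((∃ i : ℕ, 1 ≤ i ∧ ∃ u ∈ Icc x y, gf s u = (tent s)^[i] (1 / 2)) ∧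
      ∃ v ∈ Icc x y, ∃ v' ∈ Icc x y, min ((y - x) / 2) d ≤ |gf s v - gf s v'|)) ?_ ?_ y
  · intro y hy x _
    refine Or.inl ⟨1, 0, by simp, fun t ht => ?_⟩
    rw [gf_small h1 (by linarith [ht.2])]; ring
  · intro y ih x hxy
    have hsc : ∀ t ∈ Icc x y, t / s ∈ Icc (x / s) (y / s) := fun t ht =>
      ⟨div_le_div_of_nonneg_right ht.1 hs.le, div_le_div_of_nonneg_right ht.2 hs.le⟩
    have hsc' : ∀ t ∈ Icc (x / s) (y / s), s * t ∈ Icc x y := fun t ht => by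
      have h1 := ht.1
      have h2 := ht.2
      rw [div_le_iff₀ hs] at h1
      rw [le_div_iff₀ hs] at h2
      exact ⟨by linarith, by linarith⟩
    by_cases hc : ∃ t0 ∈ Icc x y, gf s (t0 / s) = 1 / 2
    · obtain ⟨t0, ht0, hg0⟩ := hc
      have hgt0 : gf s t0 = tent s (1 / 2) := by rw [gf_step h1, hg0]
      have key : ∀ t, |gf s t - gf s t0| = s * |gf s (t / s) - 1 / 2| := by
        intro t
        rw [hgt0, gf_step h1 t, tent_eq hs.le, tent_eq hs.le]
        have e : s / 2 - s * |gf s (t / s) - 1 / 2| - (s / 2 - s * |(1 / 2 : ℝ) - 1 / 2|)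
          = -(s * |gf s (t / s) - 1 / 2|) := by simp
        rw [e, abs_neg, abs_of_nonneg (by positivity)]
      refine Or.inr ⟨⟨1, le_rfl, t0, ht0, by rw [hgt0]; rfl⟩, ?_⟩
      rcases ih (x / s) (div_le_div_of_nonneg_right hxy hs.le) with ⟨σ, e, hσ, haff⟩ | ⟨⟨i, hi, u, hu, hgu⟩, _⟩
      · have key2 : ∀ t ∈ Icc x y, |gf s t - gf s t0| = |t - t0| := by
          intro t ht
          rw [key, ← hg0, haff _ (hsc t ht), haff _ (hsc t0 ht0)]
          have e : σ * (t / s) + e - (σ * (t0 / s) + e) = σ * ((t - t0) / s) := by ring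
          rw [e, abs_mul, hσ, abs_div, abs_of_pos hs]; field_simp
        rcases le_total ((y - x) / 2) (t0 - x) with h | h
        · refine ⟨x, ⟨le_rfl, hxy⟩, t0, ht0, (min_le_left _ _).trans ?_⟩
          rw [key2 x ⟨le_rfl, hxy⟩, abs_sub_comm]
          exact h.trans (le_abs_self _)
        · refine ⟨y, ⟨hxy, le_rfl⟩, t0, ht0, (min_le_left _ _).trans ?_⟩
          rw [key2 y ⟨hxy, le_rfl⟩]
          refine le_trans ?_ (le_abs_self _)
          linarith
      · refine ⟨s * u, hsc' u hu, t0, ht0, (min_le_right _ _).trans ?_⟩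
        rw [key, show s * u / s = u by field_simp, hgu]
        have := H.hrec i hi
        nlinarith [H.hd]
    · have hc' : (∀ t ∈ Icc x y, gf s (t / s) < 1 / 2) ∨ (∀ t ∈ Icc x y, 1 / 2 < gf s (t / s)) := by
        by_contra hcon
        push Not at hcon
        obtain ⟨⟨t, ht, h⟩, ⟨t', ht', h'⟩⟩ := hcon
        have hcont : ContinuousOn (fun t => gf s (t / s)) (Icc x y) :=
          ((gf_cont h1).comp (continuous_id.div_const _)).continuousOn
        have := (isPreconnected_Icc (a := x) (b := y)).intermediate_value ht' ht hcont
        obtain ⟨t0, ht0, hh⟩ := this ⟨h', h⟩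
        exact hc ⟨t0, ht0, hh⟩
      have hT : ∃ τ f : ℝ, |τ| = 1 ∧ ∀ t ∈ Icc x y, gf s t = τ * s * gf s (t / s) + f := by
        rcases hc' with h | h
        · refine ⟨1, 0, by simp, fun t ht => ?_⟩
          rw [gf_step h1, tent_left hs.le (h t ht).le]; ring
        · refine ⟨-1, s, by simp, fun t ht => ?_⟩
          rw [gf_step h1, tent_right hs.le (h t ht).le]; ring
      obtain ⟨τ, f, hτ, hT⟩ := hT
      rcases ih (x / s) (div_le_div_of_nonneg_right hxy hs.le) with
        ⟨σ, e, hσ, haff⟩ | ⟨⟨i, hi, u, hu, hgu⟩, v, hv, v', hv', hvv⟩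
      · refine Or.inl ⟨τ * σ, τ * s * e + f, by rw [abs_mul, hτ, hσ, one_mul], fun t ht => ?_⟩
        rw [hT t ht, haff _ (hsc t ht)]; field_simp; ring
      · refine Or.inr ⟨⟨i + 1, by omega, s * u, hsc' u hu, ?_⟩, s * v, hsc' v hv, s * v', hsc' v' hv', ?_⟩
        · rw [gf_scale h1, hgu, iterate_succ_apply']
        · rw [hT _ (hsc' v hv), hT _ (hsc' v' hv'), show s * v / s = v by field_simp,
            show s * v' / s = v' by field_simp]
          have e : τ * s * gf s v + f - (τ * s * gf s v' + f) = τ * (s * (gf s v - gf s v')) := by ring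
          rw [e, abs_mul, hτ, abs_mul, abs_of_pos hs, one_mul]
          rcases le_total ((y - x) / 2) d with h | h
          · rw [min_eq_left h]
            have h3 : (y / s - x / s) / 2 ≤ d := by
              refine le_trans ?_ h
              rw [← sub_div]
              have : (y - x) / s ≤ y - x := div_le_self (by linarith) h1.le
              linarith
            rw [min_eq_left h3] at hvv
            calc (y - x) / 2 = s * ((y / s - x / s) / 2) := by field_simp
              _ ≤ _ := mul_le_mul_of_nonneg_left hvv hs.le
          · rw [min_eq_right h]
            rcases le_total ((y / s - x / s) / 2) d with h3 | h3
            · rw [min_eq_left h3] at hvv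
              calc d ≤ (y - x) / 2 := h
                _ = s * ((y / s - x / s) / 2) := by field_simp
                _ ≤ _ := mul_le_mul_of_nonneg_left hvv hs.le
            · rw [min_eq_right h3] at hvv
              nlinarith [H.hd, abs_nonneg (gf s v - gf s v')]

lemma len (H : Hyp s d) {x y : ℝ} (hxy : x ≤ y) :
    ∃ v ∈ Icc x y, ∃ v' ∈ Icc x y, min ((y - x) / 2) d ≤ |gf s v - gf s v'| := by
  rcases H.dich y x hxy with ⟨σ, e, hσ, haff⟩ | ⟨_, h⟩
  · refine ⟨x, ⟨le_rfl, hxy⟩, y, ⟨hxy, le_rfl⟩, (min_le_left _ _).trans ?_⟩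
    rw [haff x ⟨le_rfl, hxy⟩, haff y ⟨hxy, le_rfl⟩]
    have : σ * x + e - (σ * y + e) = σ * (x - y) := by ring
    rw [this, abs_mul, hσ, abs_sub_comm, one_mul, abs_of_nonneg (by linarith)]
    linarith
  · exact h

lemma sep (H : Hyp s d) {x y : ℝ} (hxy : x ≤ y) (h : ∀ t ∈ Icc x y, |gf s t - 1 / 2| < d) :
    ∃ σ e : ℝ, |σ| = 1 ∧ ∀ t ∈ Icc x y, gf s t = σ * t + e := by
  rcases H.dich y x hxy with h' | ⟨⟨i, hi, u, hu, hgu⟩, _⟩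
  · exact h'
  · have := h u hu
    rw [hgu] at this
    exact absurd (H.hrec i hi) (not_le.2 this)

end Hyp
/-! ### Comparison of two arcs of the ray -/

namespace Hyp
variable {s d : ℝ}

lemma near_transfer (H : Hyp s d) {n j : ℕ} {w K : ℝ}
    (h : |GG s (n + j) w - 1 / 2| ≤ K / s ^ (n + j)) :
    |GG s n w - (tent s)^[j] (1 / 2)| ≤ K / s ^ n := by
  rw [GG_iter H.h1 n j]
  refine (tent_iter_lip H.s0.le _ _ _).trans ?_
  have hs := H.s0
  calc s ^ j * |GG s (n + j) w - 1 / 2| ≤ s ^ j * (K / s ^ (n + j)) :=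
        mul_le_mul_of_nonneg_left h (by positivity)
    _ = K / s ^ n := by rw [pow_add]; field_simp

lemma div_pow_le_self' (H : Hyp s d) {K : ℝ} (hK : 0 ≤ K) (n : ℕ) : K / s ^ n ≤ K :=
  div_le_self hK (one_le_pow₀ H.h1.le)

lemma not_lt_of_near (H : Hyp s d) {m m' : ℕ} {w K K' : ℝ} (hK : 0 ≤ K) (hK' : 0 ≤ K')
    (hlt : m < m') (h : |GG s m w - 1 / 2| ≤ K / s ^ m) (h' : |GG s m' w - 1 / 2| ≤ K' / s ^ m') :
    d ≤ K + K' := by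
  obtain ⟨j, rfl⟩ := Nat.exists_eq_add_of_lt hlt
  rw [add_assoc] at h'
  have h2 := H.near_transfer h'
  have h3 := H.hrec (j + 1) (by omega)
  have h4 := abs_sub_le ((tent s)^[j + 1] (1 / 2)) (GG s m w) (1 / 2)
  rw [abs_sub_comm _ (GG s m w)] at h4
  linarith [H.div_pow_le_self' hK m, H.div_pow_le_self' hK' m]

lemma uniq (H : Hyp s d) {m m' : ℕ} {w K K' : ℝ} (hK : 0 ≤ K) (hK' : 0 ≤ K') (hd : K + K' < d)
    (h : |GG s m w - 1 / 2| ≤ K / s ^ m) (h' : |GG s m' w - 1 / 2| ≤ K' / s ^ m') : m = m' := by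
  rcases lt_trichotomy m m' with hl | hl | hl
  · linarith [H.not_lt_of_near hK hK' hl h h']
  · exact hl
  · linarith [H.not_lt_of_near hK' hK hl h' h]

lemma inj_of (H : Hyp s d) {β : ℝ → ℝ} {p q : ℝ} (hpq : p ≤ q) (hc : ContinuousOn β (Icc p q))
    (hne : β p ≠ β q) (h : ∀ u ∈ Icc p q, |gf s (β u) - 1 / 2| < d) :
    gf s (β p) ≠ gf s (β q) := by
  have hiv : uIcc (β p) (β q) ⊆ β '' uIcc p q :=
    intermediate_value_uIcc (by rwa [uIcc_of_le hpq])
  rw [uIcc_of_le hpq] at hiv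
  obtain ⟨σ, e, hσ, haff⟩ := H.sep (x := min (β p) (β q)) (y := max (β p) (β q)) min_le_max (by
    intro t ht
    obtain ⟨u, hu, rfl⟩ := hiv ht
    exact h u hu)
  rw [haff _ ⟨min_le_left _ _, le_max_left _ _⟩, haff _ ⟨min_le_right _ _, le_max_right _ _⟩]
  intro heq
  apply hne
  have : σ ≠ 0 := by rintro rfl; simp at hσ
  exact mul_left_cancel₀ this (by linarith)

end Hyp

/-- The relative side of two functions does not change. -/
lemma cross_aux {x y e : ℝ} (hxy : x ≤ y) {A B : ℝ → ℝ} (hA : ContinuousOn A (Icc x y))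
    (hB : ContinuousOn B (Icc x y)) (he : 0 < e)
    (k1 : ∀ u ∈ Icc x y, 2 * e ≤ |A u| → B u ≠ 0)
    (k2 : ∀ u ∈ Icc x y, |A u| ≤ 2 * e → |(|A u| - |B u|)| ≤ e)
    (iA : ∀ p q, x ≤ p → p < q → q ≤ y → (∀ u ∈ Icc p q, |A u| ≤ 2 * e) → A p ≠ A q)
    (iB : ∀ p q, x ≤ p → p < q → q ≤ y → (∀ u ∈ Icc p q, |B u| ≤ 3 * e) → B p ≠ B q)
    (hx : 2 * e ≤ |A x|) (hy : 2 * e ≤ |A y|) (hP : 0 < A x * B x) : 0 < A y * B y := by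
  by_contra hcon
  push Not at hcon
  have hAB : ContinuousOn (fun u => A u * B u) (Icc x y) := hA.mul hB
  have hne : ∀ u ∈ Icc x y, 2 * e ≤ |A u| → A u * B u ≠ 0 := by
    intro u hu h
    refine mul_ne_zero ?_ (k1 u hu h)
    intro h0; rw [h0, abs_zero] at h; linarith
  have hS : IsCompact (Icc x y ∩ {u | 2 * e ≤ |A u|} ∩ {u | 0 ≤ A u * B u}) := by
    have c1 : IsClosed (Icc x y ∩ (fun u => |A u|) ⁻¹' Ici (2 * e)) :=
      hA.abs.preimage_isClosed_of_isClosed isClosed_Icc isClosed_Ici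
    have c2 : IsClosed (Icc x y ∩ (fun u => A u * B u) ⁻¹' Ici 0) :=
      hAB.preimage_isClosed_of_isClosed isClosed_Icc isClosed_Ici
    refine isCompact_Icc.of_isClosed_subset (c1.inter c2 |> fun h => ?_) (fun u hu => hu.1.1)
    convert h using 1
    ext u; simp only [mem_inter_iff, mem_setOf_eq, mem_preimage, mem_Ici]; tauto
  obtain ⟨p, ⟨⟨hp, hpA⟩, hpP⟩, hpmax⟩ := hS.exists_isGreatest ⟨x, ⟨⟨⟨le_rfl, hxy⟩, hx⟩, hP.le⟩⟩
  simp only [mem_setOf_eq] at hpA hpP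
  have hS' : IsCompact (Icc p y ∩ {u | 2 * e ≤ |A u|} ∩ {u | A u * B u ≤ 0}) := by
    have hsub : Icc p y ⊆ Icc x y := Icc_subset_Icc_left hp.1
    have c1 : IsClosed (Icc p y ∩ (fun u => |A u|) ⁻¹' Ici (2 * e)) :=
      (hA.mono hsub).abs.preimage_isClosed_of_isClosed isClosed_Icc isClosed_Ici
    have c2 : IsClosed (Icc p y ∩ (fun u => A u * B u) ⁻¹' Iic 0) :=
      (hAB.mono hsub).preimage_isClosed_of_isClosed isClosed_Icc isClosed_Iic
    refine isCompact_Icc.of_isClosed_subset (c1.inter c2 |> fun h => ?_) (fun u hu => hu.1.1)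
    convert h using 1
    ext u; simp only [mem_inter_iff, mem_setOf_eq, mem_preimage, mem_Ici, mem_Iic]; tauto
  obtain ⟨q, ⟨⟨hq, hqA⟩, hqP⟩, hqmin⟩ := hS'.exists_isLeast ⟨y, ⟨⟨⟨hp.2, le_rfl⟩, hy⟩, hcon⟩⟩
  simp only [mem_setOf_eq] at hqA hqP
  have hqI : q ∈ Icc x y := ⟨hp.1.trans hq.1, hq.2⟩
  have hpP' : 0 < A p * B p := lt_of_le_of_ne hpP (hne p hp hpA).symm
  have hqP' : A q * B q < 0 := lt_of_le_of_ne hqP (hne q hqI hqA)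
  have hpq : p < q := by
    refine lt_of_le_of_ne hq.1 ?_
    rintro rfl; linarith
  have hsub : Icc p q ⊆ Icc x y := Icc_subset_Icc hp.1 hq.2
  have hIoo : ∀ u ∈ Ioo p q, |A u| ≤ 2 * e := by
    intro u hu
    by_contra hlt
    push Not at hlt
    have huI : u ∈ Icc x y := hsub ⟨hu.1.le, hu.2.le⟩
    rcases le_total 0 (A u * B u) with h | h
    · exact absurd (hpmax ⟨⟨huI, hlt.le⟩, h⟩) (not_le.2 hu.1)
    · exact absurd (hqmin ⟨⟨⟨hu.1.le, huI.2⟩, hlt.le⟩, h⟩) (not_le.2 hu.2)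
  have hIcc : ∀ u ∈ Icc p q, |A u| ≤ 2 * e := by
    have hcl : IsClosed (Icc p q ∩ (fun u => |A u|) ⁻¹' Iic (2 * e)) :=
      (hA.mono hsub).abs.preimage_isClosed_of_isClosed isClosed_Icc isClosed_Iic
    have h : closure (Ioo p q) ⊆ Icc p q ∩ (fun u => |A u|) ⁻¹' Iic (2 * e) :=
      closure_minimal (fun u hu => ⟨⟨hu.1.le, hu.2.le⟩, hIoo u hu⟩) hcl
    rw [closure_Ioo hpq.ne] at h
    exact fun u hu => (h hu).2
  have hpm : p ∈ Icc p q := ⟨le_rfl, hpq.le⟩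
  have hqm : q ∈ Icc p q := ⟨hpq.le, le_rfl⟩
  have hpe : |A p| = 2 * e := le_antisymm (hIcc p hpm) hpA
  have hqe : |A q| = 2 * e := le_antisymm (hIcc q hqm) hqA
  have hneA := iA p q hp.1 hpq hq.2 hIcc
  have hopp : A q = -A p := by
    rcases abs_eq_abs.1 (hqe.trans hpe.symm) with h | h
    · exact absurd h.symm hneA
    · exact h
  have hB3 : ∀ u ∈ Icc p q, |B u| ≤ 3 * e := by
    intro u hu
    have h := abs_le.1 (k2 u (hsub hu) (hIcc u hu))
    linarith [hIcc u hu, h.1]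
  have hBinj : InjOn B (Icc p q) := by
    intro u hu v hv huv
    by_contra hne'
    rcases lt_or_gt_of_ne hne' with h | h
    · exact iB u v (hp.1.trans hu.1) h (hv.2.trans hq.2)
        (fun t ht => hB3 t ⟨hu.1.trans ht.1, ht.2.trans hv.2⟩) huv
    · exact iB v u (hp.1.trans hv.1) h (hu.2.trans hq.2)
        (fun t ht => hB3 t ⟨hv.1.trans ht.1, ht.2.trans hu.2⟩) huv.symm
  have hiv : uIcc (A p) (A q) ⊆ A '' uIcc p q :=
    intermediate_value_uIcc (by rw [uIcc_of_le hpq.le]; exact hA.mono hsub)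
  obtain ⟨r, hr, hr0⟩ := hiv (show (0 : ℝ) ∈ uIcc (A p) (A q) by
    rw [hopp, mem_uIcc]
    rcases le_total 0 (A p) with h | h
    · right; constructor <;> linarith
    · left; constructor <;> linarith)
  rw [uIcc_of_le hpq.le] at hr
  have hBr : |B r| ≤ e := by
    have h := k2 r (hsub hr) (hIcc r hr)
    rw [hr0, abs_zero, zero_sub, abs_neg, abs_abs] at h
    exact h
  have hpr : p < r := by
    refine lt_of_le_of_ne hr.1 ?_
    rintro rfl; rw [hr0, abs_zero] at hpe; linarith
  have hrq : r < q := by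
    refine lt_of_le_of_ne hr.2 ?_
    rintro rfl; rw [hr0, abs_zero] at hqe; linarith
  have hBp : e ≤ |B p| := by
    have h := abs_le.1 (k2 p hp (hIcc p hpm)); linarith [h.2]
  have hBq : e ≤ |B q| := by
    have h := abs_le.1 (k2 q hqI (hIcc q hqm)); linarith [h.2]
  have hBpq : 0 < B p * B q := by
    rw [hopp] at hqP'
    have h3 : 0 < (A p * B p) * (A p * B q) := mul_pos hpP' (by linarith)
    have h4 : (A p * B p) * (A p * B q) = A p ^ 2 * (B p * B q) := by ring
    rw [h4] at h3
    exact pos_of_mul_pos_right h3 (sq_nonneg _)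
  have hBr' := abs_le.1 hBr
  rcases pos_and_pos_or_neg_and_neg_of_mul_pos hBpq with ⟨b1, b2⟩ | ⟨b1, b2⟩
  · rw [abs_of_pos b1] at hBp
    rw [abs_of_pos b2] at hBq
    rcases (hB.mono hsub).strictMonoOn_of_injOn_Icc' hpq.le hBinj with h | h
    · linarith [h hpm hr hpr]
    · linarith [h hr hqm hrq]
  · rw [abs_of_neg b1] at hBp
    rw [abs_of_neg b2] at hBq
    rcases (hB.mono hsub).strictMonoOn_of_injOn_Icc' hpq.le hBinj with h | h
    · linarith [h hr hqm hrq]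
    · linarith [h hpm hr hpr]

lemma cross_iff {x y e : ℝ} (hxy : x ≤ y) {A B : ℝ → ℝ} (hA : ContinuousOn A (Icc x y))
    (hB : ContinuousOn B (Icc x y)) (he : 0 < e)
    (k1 : ∀ u ∈ Icc x y, 2 * e ≤ |A u| → B u ≠ 0)
    (k2 : ∀ u ∈ Icc x y, |A u| ≤ 2 * e → |(|A u| - |B u|)| ≤ e)
    (iA : ∀ p q, x ≤ p → p < q → q ≤ y → (∀ u ∈ Icc p q, |A u| ≤ 2 * e) → A p ≠ A q)
    (iB : ∀ p q, x ≤ p → p < q → q ≤ y → (∀ u ∈ Icc p q, |B u| ≤ 3 * e) → B p ≠ B q)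
    (hx : 2 * e ≤ |A x|) (hy : 2 * e ≤ |A y|) : 0 < A x * B x ↔ 0 < A y * B y := by
  refine ⟨cross_aux hxy hA hB he k1 k2 iA iB hx hy, fun h => ?_⟩
  by_contra hcon
  push Not at hcon
  have hx0 : A x * B x ≠ 0 := by
    refine mul_ne_zero ?_ (k1 x ⟨le_rfl, hxy⟩ hx)
    intro h0; rw [h0, abs_zero] at hx; linarith
  have hneg : 0 < A x * (fun u => -B u) x := by
    have := lt_of_le_of_ne hcon hx0
    simp only [mul_neg]; linarith
  have := cross_aux hxy hA (B := fun u => -B u) hB.neg he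
    (fun u hu h => neg_ne_zero.2 (k1 u hu h)) (fun u hu h => by rw [abs_neg]; exact k2 u hu h) iA
    (fun p q h1 h2 h3 h4 h5 => iB p q h1 h2 h3 (fun u hu => by
      have := h4 u hu; rwa [abs_neg] at this) (neg_injective h5)) hx hy hneg
  simp only [mul_neg] at this
  linarith

/-- Two arcs are close in the `n`-th coordinate. -/
def EE (s ε : ℝ) (a b : ℝ → ℝ) (U : ℝ) (n : ℕ) : Prop :=
  ∀ u ∈ Icc 0 U, |GG s n (a u) - GG s n (b u)| ≤ ε / s ^ n ∨
    (|GG s n (a u) - GG s n (b u)| ≤ 5 * ε / s ^ n ∧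
      ∃ j, 1 ≤ j ∧ j ≤ n ∧ |GG s j (a u) - 1 / 2| < 2 * ε / s ^ j)

/-- At some parameter, the two arcs are unambiguously on the same side. -/
def PP (s ε : ℝ) (a b : ℝ → ℝ) (U : ℝ) (n : ℕ) : Prop :=
  ∃ u ∈ Icc 0 U, 2 * ε / s ^ n ≤ |GG s n (a u) - 1 / 2| ∧
    0 < (GG s n (a u) - 1 / 2) * (GG s n (b u) - 1 / 2)

lemma abs_sub_of_same {x y : ℝ} (h : 0 < x * y) : |x - y| = |(|x| - |y|)| := by
  rcases pos_and_pos_or_neg_and_neg_of_mul_pos h with ⟨a, b⟩ | ⟨a, b⟩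
  · rw [abs_of_pos a, abs_of_pos b]
  · rw [abs_of_neg a, abs_of_neg b, ← abs_neg]; congr 1; ring

namespace Hyp
variable {s d : ℝ}

lemma EE.le {ε : ℝ} {a b : ℝ → ℝ} {U : ℝ} {n : ℕ} (H : Hyp s d) (hε : 0 < ε)
    (h : EE s ε a b U n) : ∀ u ∈ Icc 0 U, |GG s n (a u) - GG s n (b u)| ≤ 5 * ε / s ^ n := by
  intro u hu
  have hs := H.s0
  rcases h u hu with h | ⟨h, _⟩
  · exact h.trans (div_le_div_of_nonneg_right (by linarith) (by positivity))
  · exact h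

lemma abs_tent_sub (H : Hyp s d) (x y : ℝ) :
    |tent s x - tent s y| = s * |(|x - 1 / 2| - |y - 1 / 2|)| := by
  rw [tent_eq H.s0.le, tent_eq H.s0.le]
  have e : s / 2 - s * |x - 1 / 2| - (s / 2 - s * |y - 1 / 2|)
      = -(s * (|x - 1 / 2| - |y - 1 / 2|)) := by ring
  rw [e, abs_neg, abs_mul, abs_of_pos H.s0]

lemma GG_sides (H : Hyp s d) (n : ℕ) (x y : ℝ) {K : ℝ}
    (h : |GG s n x - GG s n y| ≤ K / s ^ n) :
    |(|GG s (n + 1) x - 1 / 2| - |GG s (n + 1) y - 1 / 2|)| ≤ K / s ^ (n + 1) := by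
  have hs := H.s0
  rw [GG_succ H.h1 n x, GG_succ H.h1 n y, H.abs_tent_sub] at h
  rw [pow_succ, ← div_div, le_div_iff₀ hs]
  linarith

lemma step (H : Hyp s d) {ε U : ℝ} {a b : ℝ → ℝ} {n : ℕ} (hε : 0 < ε) (hεd : 8 * ε < d)
    (ha : ContinuousOn a (Icc 0 U)) (hb : ContinuousOn b (Icc 0 U))
    (hai : InjOn a (Icc 0 U)) (hbi : InjOn b (Icc 0 U))
    (hE : EE s ε a b U n) (hP : PP s ε a b U (n + 1)) : EE s ε a b U (n + 1) := by
  have hs := H.s0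
  have hpos : 0 < s ^ (n + 1) := by positivity
  obtain ⟨u1, hu1, hamb1, hP1⟩ := hP
  set e := ε / s ^ (n + 1) with he
  have he0 : 0 < e := by positivity
  have hed : 8 * e < d := lt_of_le_of_lt (by
    have := H.div_pow_le_self' hε.le (n + 1); linarith) hεd
  have e2 : ∀ c : ℝ, c * ε / s ^ (n + 1) = c * e := fun c => by rw [he]; ring
  set A : ℝ → ℝ := fun u => GG s (n + 1) (a u) - 1 / 2 with hA
  set B : ℝ → ℝ := fun u => GG s (n + 1) (b u) - 1 / 2 with hB
  have hAc : ContinuousOn A (Icc 0 U) :=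
    ((GG_cont H.h1 _).comp_continuousOn ha).sub continuousOn_const
  have hBc : ContinuousOn B (Icc 0 U) :=
    ((GG_cont H.h1 _).comp_continuousOn hb).sub continuousOn_const
  have hfar : ∀ u, (∃ j, 1 ≤ j ∧ j ≤ n ∧ |GG s j (a u) - 1 / 2| < 2 * ε / s ^ j) →
      6 * e < |A u| := by
    rintro u ⟨j, hj1, hjn, hj⟩
    by_contra hcon
    push Not at hcon
    rw [← e2] at hcon
    have := H.not_lt_of_near (by positivity) (by positivity) (Nat.lt_succ_of_le hjn) hj.le hcon
    linarith
  have k2 : ∀ u ∈ Icc 0 U, |A u| ≤ 2 * e → |(|A u| - |B u|)| ≤ e := by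
    intro u hu h
    rcases hE u hu with h' | ⟨_, h'⟩
    · exact H.GG_sides n _ _ h'
    · linarith [hfar u h']
  have k1 : ∀ u ∈ Icc 0 U, 2 * e ≤ |A u| → B u ≠ 0 := by
    intro u hu h h0
    rcases hE u hu with h' | ⟨h'', h'⟩
    · have h3 : |(|A u| - |B u|)| ≤ e := H.GG_sides n _ _ h'
      rw [h0, abs_zero, sub_zero, abs_abs] at h3
      linarith
    · have h3 : |(|A u| - |B u|)| ≤ 5 * ε / s ^ (n + 1) := H.GG_sides n _ _ h''
      rw [h0, abs_zero, sub_zero, abs_abs, e2] at h3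
      linarith [hfar u h']
  have inj : ∀ f : ℝ → ℝ, ContinuousOn f (Icc 0 U) → InjOn f (Icc 0 U) → ∀ p q, 0 ≤ p → p < q →
      q ≤ U → (∀ u ∈ Icc p q, |GG s (n + 1) (f u) - 1 / 2| ≤ 3 * e) →
      GG s (n + 1) (f p) - 1 / 2 ≠ GG s (n + 1) (f q) - 1 / 2 := by
    intro f hf hfi p q hp hpq hq h heq
    have hsub : Icc p q ⊆ Icc 0 U := Icc_subset_Icc hp hq
    refine H.inj_of (β := fun u => f u / s ^ (n + 1)) hpq.le ((hf.mono hsub).div_const _) ?_ ?_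
      (sub_left_injective heq)
    · intro h'
      have := hfi (hsub ⟨le_rfl, hpq.le⟩) (hsub ⟨hpq.le, le_rfl⟩)
        ((div_left_inj' hpos.ne').1 h')
      exact hpq.ne this
    · intro u hu
      exact lt_of_le_of_lt (h u hu) (by linarith)
  have main : ∀ u ∈ Icc 0 U, 2 * e ≤ |A u| → 0 < A u * B u := by
    intro u hu hu2
    rw [e2] at hamb1
    rcases le_total u1 u with h | h
    · have hsub : Icc u1 u ⊆ Icc 0 U := Icc_subset_Icc hu1.1 hu.2
      exact (cross_iff h (hAc.mono hsub) (hBc.mono hsub) he0 (fun u h => k1 u (hsub h))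
        (fun u h => k2 u (hsub h))
        (fun p q h1 h2 h3 h4 => inj a ha hai p q (hu1.1.trans h1) h2 (h3.trans hu.2)
          (fun u hu => (h4 u hu).trans (by linarith)))
        (fun p q h1 h2 h3 h4 => inj b hb hbi p q (hu1.1.trans h1) h2 (h3.trans hu.2) h4)
        hamb1 hu2).1 hP1
    · have hsub : Icc u u1 ⊆ Icc 0 U := Icc_subset_Icc hu.1 hu1.2
      exact (cross_iff h (hAc.mono hsub) (hBc.mono hsub) he0 (fun u h => k1 u (hsub h))
        (fun u h => k2 u (hsub h))
        (fun p q h1 h2 h3 h4 => inj a ha hai p q (hu.1.trans h1) h2 (h3.trans hu1.2)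
          (fun u hu => (h4 u hu).trans (by linarith)))
        (fun p q h1 h2 h3 h4 => inj b hb hbi p q (hu.1.trans h1) h2 (h3.trans hu1.2) h4)
        hu2 hamb1).2 hP1
  intro u hu
  have hABd : GG s (n + 1) (a u) - GG s (n + 1) (b u) = A u - B u := by simp only [hA, hB]; ring
  rw [hABd]
  rcases le_or_gt (2 * e) (|A u|) with h | h
  · rw [abs_sub_of_same (main u hu h)]
    rcases hE u hu with h' | ⟨h'', j, hj1, hjn, hj⟩
    · exact Or.inl (H.GG_sides n _ _ h')
    · exact Or.inr ⟨H.GG_sides n _ _ h'', j, hj1, by omega, hj⟩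
  · refine Or.inr ⟨?_, n + 1, by omega, le_rfl, by rw [e2]; exact h⟩
    have h3 := abs_le.1 (k2 u hu h.le)
    have h4 : |A u - B u| ≤ |A u| + |B u| := abs_sub _ _
    rw [e2]
    linarith [h3.1]

lemma run (H : Hyp s d) {ε U : ℝ} {a b : ℝ → ℝ} (hε : 0 < ε) (hεd : 8 * ε < d)
    (ha : ContinuousOn a (Icc 0 U)) (hb : ContinuousOn b (Icc 0 U))
    (hai : InjOn a (Icc 0 U)) (hbi : InjOn b (Icc 0 U))
    (h0 : ∀ u ∈ Icc 0 U, |gf s (a u) - gf s (b u)| ≤ ε) (m : ℕ)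
    (hP : ∀ n, 1 ≤ n → n < m → PP s ε a b U n) : ∀ n < m, EE s ε a b U n := by
  intro n
  induction n with
  | zero =>
    intro _ u hu
    left
    rw [GG_zero, GG_zero, pow_zero, div_one]
    exact h0 u hu
  | succ n ih =>
    intro hn
    exact H.step hε hεd ha hb hai hbi (ih (by omega)) (hP _ (by omega) hn)

lemma run_all (H : Hyp s d) {ε U : ℝ} {a b : ℝ → ℝ} (hε : 0 < ε)
    (hE : ∀ n, EE s ε a b U n) : ∀ u ∈ Icc 0 U, |a u - b u| ≤ 5 * ε := by
  intro u hu
  have hs := H.s0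
  obtain ⟨k, hk⟩ := exists_div_pow_le H.h1 (a u)
  obtain ⟨l, hl⟩ := exists_div_pow_le H.h1 (b u)
  have hk' := div_pow_le_of_le H.h1 (by norm_num) (le_max_left k l) hk
  have hl' := div_pow_le_of_le H.h1 (by norm_num) (le_max_right k l) hl
  have h := EE.le H hε (hE (max k l)) u hu
  have h1 := H.h1
  unfold GG at h
  rw [gf_small H.h1 (by linarith), gf_small H.h1 (by linarith), ← sub_div, abs_div,
    abs_of_pos (show 0 < s ^ (max k l) by positivity)] at h
  exact (div_le_div_iff_of_pos_right (by positivity)).1 h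

/-- same starting point, unambiguous: same side. -/
lemma PP_of_start {ε U : ℝ} {a b : ℝ → ℝ} {n : ℕ} (H : Hyp s d) (hε : 0 < ε) (hU : 0 ≤ U)
    (hab : a 0 = b 0)
    (h : 2 * ε / s ^ n ≤ |GG s n (a 0) - 1 / 2|) : PP s ε a b U n := by
  refine ⟨0, ⟨le_rfl, hU⟩, h, ?_⟩
  rw [← hab]
  have hs := H.s0
  have : 0 < 2 * ε / s ^ n := by positivity
  have h3 : GG s n (a 0) - 1 / 2 ≠ 0 := abs_pos.1 (by linarith)
  exact mul_self_pos.2 h3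

lemma exists_near (H : Hyp s d) {ε U : ℝ} {a b : ℝ → ℝ} (hε : 0 < ε) (hεd : 8 * ε < d)
    (hU : 0 ≤ U)
    (ha : ContinuousOn a (Icc 0 U)) (hb : ContinuousOn b (Icc 0 U))
    (hai : InjOn a (Icc 0 U)) (hbi : InjOn b (Icc 0 U)) (hab : a 0 = b 0)
    (h0 : ∀ u ∈ Icc 0 U, |gf s (a u) - gf s (b u)| ≤ ε) (hlong : 5 * ε < |a U - b U|) :
    ∃ m, 1 ≤ m ∧ |GG s m (a 0) - 1 / 2| < 2 * ε / s ^ m := by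
  by_contra hcon
  push Not at hcon
  have := H.run_all hε (fun n => H.run hε hεd ha hb hai hbi h0 (n + 1)
    (fun n hn _ => PP_of_start H hε hU hab (hcon n hn)) n (by omega)) U ⟨hU, le_rfl⟩
  linarith

end Hyp

def Dif (s x y l : ℝ) : Prop := ∃ v ∈ Icc x y, ∃ v' ∈ Icc x y, l ≤ gf s v - gf s v'

def Full (s x y : ℝ) : Prop := ∃ v ∈ Icc x y, ∃ v' ∈ Icc x y, gf s v = 1 / 2 ∧ gf s v' = s / 2

lemma gf_ivt {s : ℝ} (h1 : 1 < s) {x y v v' c : ℝ} (hv : v ∈ Icc x y) (hv' : v' ∈ Icc x y)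
    (h : gf s v ≤ c) (h' : c ≤ gf s v') : ∃ u ∈ Icc x y, gf s u = c := by
  obtain ⟨u, hu, e⟩ := isPreconnected_Icc.intermediate_value hv hv' (gf_cont h1).continuousOn ⟨h, h'⟩
  exact ⟨u, hu, e⟩

lemma scale_mem {s : ℝ} (hs : 0 < s) {x y v : ℝ} (hv : v ∈ Icc x y) : s * v ∈ Icc (s * x) (s * y) :=
  ⟨mul_le_mul_of_nonneg_left hv.1 hs.le, mul_le_mul_of_nonneg_left hv.2 hs.le⟩

namespace Hyp
variable {s d : ℝ}

lemma Full_scale (H : Hyp s d) {x y : ℝ} (h : Full s x y) : Full s (s * x) (s * y) := by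
  obtain ⟨v, hv, v', hv', e, e'⟩ := h
  have hs := H.s0
  have h1 : gf s (s * v) = s / 2 := by rw [gf_scale H.h1, e, tent_left hs.le le_rfl]; ring
  have h2 : gf s (s * v') = s * (1 - s / 2) := by
    rw [gf_scale H.h1, e', tent_right hs.le (by linarith [H.h1])]
  obtain ⟨u, hu, hu'⟩ := gf_ivt (c := 1 / 2) H.h1 (scale_mem hs hv') (scale_mem hs hv)
    (by rw [h2]; nlinarith [H.h1, sq_nonneg (s - 1)]) (by rw [h1]; linarith [H.h1])
  exact ⟨u, hu, _, scale_mem hs hv, hu', h1⟩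

lemma Dif_scale (H : Hyp s d) {x y l : ℝ} (h : Dif s x y l) :
    Dif s (s * x) (s * y) (s * l) ∨ ∃ w ∈ Icc (s * x) (s * y), ∃ z ∈ Icc (s * x) (s * y),
      gf s w = s / 2 ∧ s * l / 2 ≤ s / 2 - gf s z := by
  obtain ⟨v, hv, v', hv', e⟩ := h
  have hs := H.s0
  by_cases c1 : 1 / 2 ≤ gf s v'
  · by_cases c2 : 1 / 2 ≤ gf s v
    · left
      refine ⟨_, scale_mem hs hv', _, scale_mem hs hv, ?_⟩
      rw [gf_scale H.h1, gf_scale H.h1, tent_right hs.le c1, tent_right hs.le c2]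
      nlinarith
    · push Not at c2
      obtain ⟨u, hu, e1⟩ := gf_ivt H.h1 hv hv' c2.le c1
      right
      refine ⟨_, scale_mem hs hu, _, scale_mem hs hv, ?_, ?_⟩
      · rw [gf_scale H.h1, e1, tent_left hs.le le_rfl]; ring
      · rw [gf_scale H.h1, tent_left hs.le c2.le]; nlinarith
  · push Not at c1
    by_cases c2 : 1 / 2 ≤ gf s v
    · obtain ⟨u, hu, e1⟩ := gf_ivt H.h1 hv' hv c1.le c2
      right
      have e2 : gf s (s * u) = s / 2 := by rw [gf_scale H.h1, e1, tent_left hs.le le_rfl]; ring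
      by_cases c3 : l / 2 ≤ gf s v - 1 / 2
      · refine ⟨_, scale_mem hs hu, _, scale_mem hs hv, e2, ?_⟩
        rw [gf_scale H.h1, tent_right hs.le c2]; nlinarith
      · push Not at c3
        refine ⟨_, scale_mem hs hu, _, scale_mem hs hv', e2, ?_⟩
        rw [gf_scale H.h1, tent_left hs.le c1.le]; nlinarith
    · push Not at c2
      left
      refine ⟨_, scale_mem hs hv, _, scale_mem hs hv', ?_⟩
      rw [gf_scale H.h1, gf_scale H.h1, tent_left hs.le c1.le, tent_left hs.le c2.le]
      nlinarith

lemma Dif_scale2 (H : Hyp s d) {x y l : ℝ} (hl : 0 ≤ l) (h : Dif s x y l) :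
    Dif s (s * (s * x)) (s * (s * y)) (s ^ 2 / 2 * l) ∨ Full s (s * (s * x)) (s * (s * y)) := by
  have hs := H.s0
  rcases H.Dif_scale h with h | ⟨w, hw, z, hz, e1, e2⟩
  · left
    rcases H.Dif_scale h with ⟨v, hv, v', hv', e⟩ | ⟨w, hw, z, hz, e1, e2⟩
    · refine ⟨v, hv, v', hv', ?_⟩
      nlinarith [mul_nonneg (mul_nonneg hs.le hs.le) hl]
    · exact ⟨w, hw, z, hz, by rw [e1]; linarith⟩
  · by_cases c : 1 / 2 ≤ gf s z
    · left
      refine ⟨_, scale_mem hs hz, _, scale_mem hs hw, ?_⟩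
      rw [gf_scale H.h1, gf_scale H.h1, e1, tent_right hs.le c,
        tent_right hs.le (by linarith [H.h1])]
      nlinarith
    · push Not at c
      right
      obtain ⟨u, hu, e3⟩ := gf_ivt (c := 1 / 2) H.h1 hz hw c.le (by rw [e1]; linarith [H.h1])
      exact H.Full_scale ⟨u, hu, w, hw, e3, e1⟩

lemma Dif_iter (H : Hyp s d) (n : ℕ) : ∀ {x y l : ℝ}, 0 ≤ l → Dif s x y l →
    Dif s ((s ^ 2) ^ n * x) ((s ^ 2) ^ n * y) ((s ^ 2 / 2) ^ n * l) ∨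
      Full s ((s ^ 2) ^ n * x) ((s ^ 2) ^ n * y) := by
  induction n with
  | zero => intro x y l hl h; left; simpa using h
  | succ n ih =>
    intro x y l hl h
    have e : ∀ x, (s ^ 2) ^ (n + 1) * x = s * (s * ((s ^ 2) ^ n * x)) := by intro x; ring
    rw [e, e]
    rcases ih hl h with h | h
    · have := H.Dif_scale2 (by positivity) h
      rwa [← mul_assoc (s ^ 2 / 2), ← pow_succ'] at this
    · right; exact H.Full_scale (H.Full_scale h)

lemma cov (H : Hyp s d) : ∃ C > 0, ∀ x ≥ 0, ∃ t ∈ Icc x (x + C), gf s t = 1 / 2 := by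
  have hs := H.s0
  have hd := H.hd
  obtain ⟨n, hn⟩ := pow_unbounded_of_one_lt (1 / d) (show 1 < s ^ 2 / 2 by linarith [H.hsq])
  refine ⟨(s ^ 2) ^ n * (2 * d), by positivity, fun x hx => ?_⟩
  have hD : Dif s (x / (s ^ 2) ^ n) (x / (s ^ 2) ^ n + 2 * d) d := by
    obtain ⟨v, hv, v', hv', h⟩ := H.len (x := x / (s ^ 2) ^ n) (y := x / (s ^ 2) ^ n + 2 * d)
      (by linarith)
    rw [show (x / (s ^ 2) ^ n + 2 * d - x / (s ^ 2) ^ n) / 2 = d by ring, min_self] at h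
    rcases le_total 0 (gf s v - gf s v') with c | c
    · rw [abs_of_nonneg c] at h; exact ⟨v, hv, v', hv', h⟩
    · rw [abs_of_nonpos c] at h; exact ⟨v', hv', v, hv, by linarith⟩
  have e1 : (s ^ 2) ^ n * (x / (s ^ 2) ^ n) = x := by field_simp
  have := H.Dif_iter n hd.le hD
  rw [mul_add, e1] at this
  rcases this with ⟨v, hv, v', hv', h⟩ | ⟨v, hv, v', hv', h, _⟩
  · exfalso
    have h1 := gf_nonneg H.h1 H.h2 v' (hx.trans hv'.1)
    have h2 := gf_le H.h1 v
    rw [div_lt_iff₀ hd] at hn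
    linarith [H.h2]
  · exact ⟨v, hv, h⟩

end Hyp

/-- Lifted homeomorphisms of the ray. -/
structure Good (s : ℝ) (η : ℝ → ℝ) : Prop where
  pos : ∀ t, 0 ≤ t → 0 ≤ η t
  cont : ContinuousOn η (Ici 0)
  mono : StrictMonoOn η (Ici 0)
  uc : ∀ ε > 0, ∃ M : ℕ, ∃ δ > 0, ∀ t t', 0 ≤ t → 0 ≤ t' →
    (∀ n ≤ M, |GG s n t - GG s n t'| ≤ δ) → |gf s (η t) - gf s (η t')| ≤ ε

structure GPair (s : ℝ) (η θ : ℝ → ℝ) : Prop where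
  g1 : Good s η
  g2 : Good s θ
  i1 : ∀ t, 0 ≤ t → θ (η t) = t
  i2 : ∀ t, 0 ≤ t → η (θ t) = t

lemma GPair.symm {s : ℝ} {η θ : ℝ → ℝ} (P : GPair s η θ) : GPair s θ η :=
  ⟨P.g2, P.g1, P.i2, P.i1⟩

def Symm (s p U : ℝ) (M : ℕ) : Prop := ∀ u ∈ Icc 0 U, GG s M (p + u) = GG s M (p - u)

lemma Symm.mono {s p U : ℝ} {M N : ℕ} (h1 : 1 < s) (h : Symm s p U M) (hN : N ≤ M) :
    Symm s p U N := by
  obtain ⟨j, rfl⟩ := Nat.exists_eq_add_of_le hN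
  intro u hu
  rw [GG_iter h1 N j, h u hu, ← GG_iter h1]

namespace Hyp
variable {s d : ℝ} {η θ : ℝ → ℝ}

lemma lc (H : Hyp s d) (G : Good s η) {ε : ℝ} (hε : 0 < ε) :
    ∃ δ > 0, ∀ t t', 0 ≤ t → 0 ≤ t' → |t - t'| ≤ δ → |η t - η t'| ≤ ε := by
  have hm : 0 < min (ε / 2) d := lt_min (by linarith) H.hd
  obtain ⟨M, δ, hδ, hM⟩ := G.uc (min (ε / 2) d / 2) (by linarith)
  have key : ∀ t t', 0 ≤ t → t ≤ t' → |t - t'| ≤ δ → |η t - η t'| ≤ ε := by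
    intro t t' ht htt h
    have hle : η t ≤ η t' := G.mono.monotoneOn ht (ht.trans htt) htt
    by_contra hcon
    push Not at hcon
    rw [abs_of_nonpos (by linarith)] at hcon
    rw [abs_of_nonpos (by linarith)] at h
    obtain ⟨v, hv, v', hv', hl⟩ := H.len hle
    have hiv := intermediate_value_Icc htt (G.cont.mono fun x hx => (ht.trans hx.1 : 0 ≤ x))
    obtain ⟨u, hu, rfl⟩ := hiv hv
    obtain ⟨u', hu', rfl⟩ := hiv hv'
    have h3 := hM u u' (ht.trans hu.1) (ht.trans hu'.1) (fun n _ =>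
      (GG_lip' H.h1 n u u').trans (by
        rw [abs_le]; constructor <;> linarith [hu.1, hu.2, hu'.1, hu'.2]))
    have h4 : min (ε / 2) d ≤ min ((η t' - η t) / 2) d := min_le_min_right _ (by linarith)
    linarith
  refine ⟨δ, hδ, fun t t' ht ht' h => ?_⟩
  rcases le_total t t' with c | c
  · exact key t t' ht c h
  · rw [abs_sub_comm]; exact key t' t ht' c (by rwa [abs_sub_comm])

lemma coarse (H : Hyp s d) (G : Good s η) :
    ∃ A > 0, ∀ t t', 0 ≤ t → 0 ≤ t' → |η t - η t'| ≤ A * (|t - t'| + 1) := by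
  obtain ⟨δ, hδ, hL⟩ := H.lc G (ε := 1) one_pos
  have key : ∀ n : ℕ, ∀ t t', 0 ≤ t → t ≤ t' → t' ≤ t + n * δ → |η t - η t'| ≤ n := by
    intro n
    induction n with
    | zero =>
      intro t t' ht h1 h2
      have : t' = t := by simp at h2; linarith
      simp [this]
    | succ n ih =>
      intro t t' ht h1 h2
      push_cast at h2 ⊢
      have hn : (0 : ℝ) ≤ n * δ := by positivity
      rcases le_total t' (t + n * δ) with c | c
      · linarith [ih t t' ht h1 c]
      · have k1 := ih t (t + n * δ) ht (by linarith) le_rfl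
        have k2 := hL (t + n * δ) t' (by linarith) (by linarith)
          (by rw [abs_of_nonpos (by linarith)]; linarith)
        calc |η t - η t'| ≤ |η t - η (t + n * δ)| + |η (t + n * δ) - η t'| := abs_sub_le _ _ _
          _ ≤ _ := by linarith
  have key2 : ∀ t t', 0 ≤ t → t ≤ t' → |η t - η t'| ≤ (1 / δ + 1) * (|t - t'| + 1) := by
    intro t t' ht h
    have h1 : (t' - t) / δ ≤ ⌈(t' - t) / δ⌉₊ := Nat.le_ceil _
    have h2 := Nat.ceil_lt_add_one (a := (t' - t) / δ) (div_nonneg (by linarith) hδ.le)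
    have h3 := key ⌈(t' - t) / δ⌉₊ t t' ht h (by rw [div_le_iff₀ hδ] at h1; linarith)
    rw [abs_of_nonpos (by linarith : t - t' ≤ 0)]
    have h4 : (t' - t) / δ = 1 / δ * (t' - t) := by ring
    have h5 : 0 < 1 / δ := by positivity
    nlinarith
  refine ⟨1 / δ + 1, by positivity, fun t t' ht ht' => ?_⟩
  rcases le_total t t' with c | c
  · exact key2 t t' ht c
  · rw [abs_sub_comm, abs_sub_comm t]; exact key2 t' t ht' c

/-- lower coarse bound -/
lemma coarse_low (H : Hyp s d) (P : GPair s η θ) :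
    ∃ A > 0, ∀ t t', 0 ≤ t → 0 ≤ t' → |t - t'| ≤ A * (|η t - η t'| + 1) := by
  obtain ⟨A, hA, h⟩ := H.coarse P.g2
  refine ⟨A, hA, fun t t' ht ht' => ?_⟩
  have := h (η t) (η t') (P.g1.pos t ht) (P.g1.pos t' ht')
  rwa [P.i1 t ht, P.i1 t' ht'] at this

lemma arms (G : Good s η) {p U : ℝ} (hUp : U ≤ p) :
    ContinuousOn (fun u => η (p + u)) (Icc 0 U) ∧ ContinuousOn (fun u => η (p - u)) (Icc 0 U) ∧
    InjOn (fun u => η (p + u)) (Icc 0 U) ∧ InjOn (fun u => η (p - u)) (Icc 0 U) := by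
  have m1 : MapsTo (fun u : ℝ => p + u) (Icc 0 U) (Ici 0) := fun u hu => by
    simp only [mem_Ici]; linarith [hu.1, hu.2]
  have m2 : MapsTo (fun u : ℝ => p - u) (Icc 0 U) (Ici 0) := fun u hu => by
    simp only [mem_Ici]; linarith [hu.1, hu.2]
  refine ⟨G.cont.comp (by fun_prop) m1, G.cont.comp (by fun_prop) m2, ?_, ?_⟩
  · intro u hu u' hu' h
    have := G.mono.injOn (m1 hu) (m1 hu') h
    simpa using this
  · intro u hu u' hu' h
    have := G.mono.injOn (m2 hu) (m2 hu') h
    simpa using this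

lemma arms_h0 (H : Hyp s d) {η : ℝ → ℝ} {p U ε δ : ℝ} {M N : ℕ} (hUp : U ≤ p) (hδ : 0 < δ)
    (hM : ∀ t t', 0 ≤ t → 0 ≤ t' →
    (∀ n ≤ M, |GG s n t - GG s n t'| ≤ δ) → |gf s (η t) - gf s (η t')| ≤ ε)
    (hS : Symm s p U N) (hN : M ≤ N) :
    ∀ u ∈ Icc 0 U, |gf s (η (p + u)) - gf s (η (p - u))| ≤ ε := by
  intro u hu
  refine hM _ _ (by linarith [hu.1, hu.2]) (by linarith [hu.1, hu.2]) fun n hn => ?_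
  rw [(hS.mono H.h1 (hn.trans hN)) u hu, sub_self, abs_zero]
  exact hδ.le

lemma fold_near (H : Hyp s d) (P : GPair s η θ) {ε : ℝ} (hε : 0 < ε) (hεd : 8 * ε < d) :
    ∃ M : ℕ, ∃ L : ℝ, ∀ p U, 0 ≤ U → U ≤ p → L ≤ U → ∀ N, M ≤ N → Symm s p U N →
      ∃ m, 1 ≤ m ∧ |GG s m (η p) - 1 / 2| < 2 * ε / s ^ m := by
  obtain ⟨M, δ, hδ, hM⟩ := P.g1.uc ε hε
  obtain ⟨A, hA, hlow⟩ := H.coarse_low P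
  refine ⟨M, A * (5 * ε + 1), fun p U hU hUp hL N hN hS => ?_⟩
  obtain ⟨c1, c2, c3, c4⟩ := arms P.g1 hUp
  have := H.exists_near hε hεd hU c1 c2 c3 c4 (by simp) (H.arms_h0 hUp hδ hM hS hN) (by
    have h1 := hlow (p + U) (p - U) (by linarith) (by linarith)
    rw [show p + U - (p - U) = 2 * U by ring, abs_of_nonneg (by linarith)] at h1
    by_contra hcon
    push Not at hcon
    have : A * (|η (p + U) - η (p - U)| + 1) ≤ A * (5 * ε + 1) :=
      mul_le_mul_of_nonneg_left (by linarith) hA.le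
    have : 0 < A * (5 * ε + 1) := by positivity
    linarith)
  simpa using this

lemma tent_symm (H : Hyp s d) {x y : ℝ} (h : x + y = 1) : tent s x = tent s y := by
  rw [tent_eq H.s0.le, tent_eq H.s0.le, show x - 1 / 2 = -(y - 1 / 2) by linarith, abs_neg]

lemma symm_std (H : Hyp s d) (k : ℕ) :
    Symm s (s ^ (k + 1) / 2) (s ^ (k + 1) * (s - 1) / 2) k := by
  intro u hu
  have hp : 0 < s ^ (k + 1) := pow_pos H.s0 _
  have h1 : u / s ^ (k + 1) ≤ (s - 1) / 2 := by
    rw [div_le_iff₀ hp]; linarith [hu.2]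
  have h0 : 0 ≤ u / s ^ (k + 1) := div_nonneg hu.1 hp.le
  rw [GG_succ H.h1, GG_succ H.h1 k]
  apply H.tent_symm
  unfold GG
  have e1 : (s ^ (k + 1) / 2 + u) / s ^ (k + 1) = 1 / 2 + u / s ^ (k + 1) := by field_simp
  have e2 : (s ^ (k + 1) / 2 - u) / s ^ (k + 1) = 1 / 2 - u / s ^ (k + 1) := by field_simp
  rw [e1, e2, gf_small H.h1 (by linarith), gf_small H.h1 (by linarith [H.h1])]
  ring

lemma symm_near (H : Hyp s d) {k : ℕ} {q : ℝ} (hq : GG s (k + 1) q = 1 / 2) :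
    Symm s q (d / 2 * s ^ (k + 1)) k := by
  intro u hu
  have hd := H.hd
  have hp : 0 < s ^ (k + 1) := pow_pos H.s0 _
  have h1 : u / s ^ (k + 1) ≤ d / 2 := by
    rw [div_le_iff₀ hp]; linarith [hu.2]
  have h0 : 0 ≤ u / s ^ (k + 1) := div_nonneg hu.1 hp.le
  rw [GG_succ H.h1, GG_succ H.h1 k]
  apply H.tent_symm
  unfold GG at hq ⊢
  rw [add_div, sub_div]
  set Q := q / s ^ (k + 1)
  set v := u / s ^ (k + 1)
  obtain ⟨σ, e, -, haff⟩ := H.sep (x := Q - d / 2) (y := Q + d / 2) (by linarith) (by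
    intro t ht
    have := gf_lip H.h1 t Q
    rw [hq] at this
    refine this.trans_lt ?_
    rw [abs_lt]; constructor <;> linarith [ht.1, ht.2])
  rw [haff Q ⟨by linarith, by linarith⟩] at hq
  rw [haff _ ⟨by linarith, by linarith⟩, haff _ ⟨by linarith, by linarith⟩]
  linarith

lemma exact_near (H : Hyp s d) {m : ℕ} {v K : ℝ} (hK : 0 ≤ K) (hKd : 2 * K < d)
    (h : |GG s m v - 1 / 2| ≤ K / s ^ m) : ∃ q, |q - v| ≤ K ∧ GG s m q = 1 / 2 := by
  have hp : 0 < s ^ m := pow_pos H.s0 _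
  have hKs := H.div_pow_le_self' hK m
  unfold GG at h
  set V := v / s ^ m with hV
  set ρ := K / s ^ m with hρ
  have hρ0 : 0 ≤ ρ := by positivity
  obtain ⟨σ, e, hσ, haff⟩ := H.sep (x := V - ρ) (y := V + ρ) (by linarith) (by
    intro t ht
    have := gf_lip H.h1 t V
    have h2 : |t - V| ≤ ρ := by rw [abs_le]; constructor <;> linarith [ht.1, ht.2]
    have := abs_sub_le (gf s t) (gf s V) (1 / 2)
    linarith)
  set τ := -σ * (gf s V - 1 / 2) with hτ
  have hτρ : |τ| ≤ ρ := by rw [hτ, abs_mul, abs_neg, hσ, one_mul]; exact h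
  have hσ2 : σ * σ = 1 := by rw [← abs_mul_abs_self, hσ]; norm_num
  refine ⟨v + τ * s ^ m, ?_, ?_⟩
  · rw [add_sub_cancel_left, abs_mul, abs_of_pos hp]
    rwa [hρ, le_div_iff₀ hp] at hτρ
  · unfold GG
    have e1 : (v + τ * s ^ m) / s ^ m = V + τ := by rw [hV]; field_simp
    rw [abs_le] at hτρ
    rw [e1, haff _ ⟨by linarith, by linarith⟩]
    have e2 := haff V ⟨by linarith, by linarith⟩
    rw [hτ]
    have : σ * (V + -σ * (gf s V - 1 / 2)) + e = σ * V + e - σ * σ * (gf s V - 1 / 2) := by ring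
    rw [this, hσ2, ← e2]; ring

lemma crit (H : Hyp s d) (k n : ℕ) : d ≤ |GG s n (s ^ k * (1 - s / 2)) - 1 / 2| := by
  have hs := H.s0
  have hd := H.d_le
  rcases le_total k n with c | c
  · obtain ⟨j, rfl⟩ := Nat.exists_eq_add_of_le c
    unfold GG
    have e : s ^ k * (1 - s / 2) / s ^ (k + j) = (1 - s / 2) / s ^ j := by
      rw [pow_add]; field_simp
    have h1 : (1 - s / 2) / s ^ j ≤ 1 - s / 2 := H.div_pow_le_self' (by linarith [H.h2]) j
    rw [e, gf_small H.h1 (by linarith [H.h1]), abs_of_nonpos (by linarith [H.h1])]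
    linarith
  · rcases Nat.eq_or_lt_of_le c with c | c
    · subst c
      unfold GG
      have e : s ^ n * (1 - s / 2) / s ^ n = (1 - s / 2) := by field_simp
      rw [e, gf_small H.h1 (by linarith [H.h1]), abs_of_nonpos (by linarith [H.h1])]
      linarith
    · obtain ⟨j, rfl⟩ := Nat.exists_eq_add_of_lt c
      rw [GG_iter H.h1 n (j + 1)]
      have e : GG s (n + (j + 1)) (s ^ (n + j + 1) * (1 - s / 2)) = 1 - s / 2 := by
        unfold GG
        rw [← add_assoc, mul_comm, mul_div_assoc, div_self (by positivity), mul_one,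
          gf_small H.h1 (by linarith [H.h1])]
      have e2 : tent s (1 - s / 2) = tent s (tent s (1 / 2)) := by
        apply H.tent_symm; rw [tent_left hs.le le_rfl]; ring
      rw [e, iterate_succ_apply, e2, ← iterate_succ_apply, ← iterate_succ_apply]
      exact H.hrec _ (by omega)

end Hyp

/-- `m` is the level of the image of the `k`-th turning point. -/
def Near (s : ℝ) (η : ℝ → ℝ) (ε : ℝ) (k m : ℕ) : Prop :=
  1 ≤ m ∧ |GG s m (η (s ^ k / 2)) - 1 / 2| < 2 * ε / s ^ m

namespace Hyp
variable {s d : ℝ} {η θ : ℝ → ℝ}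

lemma Near_uniq (H : Hyp s d) {ε ε' : ℝ} (hε : 0 < ε) (hε' : 0 < ε') (h : 2 * ε + 2 * ε' < d)
    {k m m' : ℕ} (h1 : Near s η ε k m) (h2 : Near s η ε' k m') : m = m' :=
  H.uniq (by linarith) (by linarith) h h1.2.le h2.2.le

lemma pow_large (H : Hyp s d) (B : ℝ) : ∃ k0 : ℕ, ∀ k ≥ k0, B < s ^ k := by
  obtain ⟨k0, h⟩ := pow_unbounded_of_one_lt B H.h1
  exact ⟨k0, fun k hk => h.trans_le (pow_le_pow_right₀ H.h1.le hk)⟩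

lemma near_exists (H : Hyp s d) (P : GPair s η θ) {ε : ℝ} (hε : 0 < ε) (hεd : 8 * ε < d) :
    ∃ k0, ∀ k ≥ k0, ∃ m, Near s η ε k m := by
  obtain ⟨M, L, h⟩ := H.fold_near P hε hεd
  have hs1 : 0 < s - 1 := by linarith [H.h1]
  obtain ⟨k1, hk1⟩ := H.pow_large (L * 2 / (s - 1))
  refine ⟨max k1 (M + 1), fun k hk => ?_⟩
  obtain ⟨j, rfl⟩ : ∃ j, k = j + 1 := ⟨k - 1, by omega⟩
  have h2 := hk1 (j + 1) (by omega)
  rw [div_lt_iff₀ hs1] at h2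
  have hp : 0 < s ^ (j + 1) := pow_pos H.s0 _
  exact h _ _ (by positivity) (by nlinarith [H.h2]) (by linarith) j (by omega) (H.symm_std j)

lemma near_upper (H : Hyp s d) (P : GPair s η θ) : ∃ C : ℕ, ∀ ε > 0, 8 * ε < d →
    ∀ k m, Near s η ε k m → m ≤ k + C := by
  obtain ⟨A, hA, hc⟩ := H.coarse P.g1
  have h00 := P.g1.pos 0 le_rfl
  obtain ⟨C, hC⟩ := pow_unbounded_of_one_lt (4 * (η 0 + 2 * A)) H.h1
  refine ⟨C, fun ε hε hεd k m hN => ?_⟩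
  have hd := H.d_le
  have hs := H.s0
  have hz : 0 ≤ s ^ k / 2 := by positivity
  have hw := P.g1.pos _ hz
  have hm : 0 < s ^ m := pow_pos H.s0 _
  have hk1 : 1 ≤ s ^ k := one_le_pow₀ H.h1.le
  have h1 := hc (s ^ k / 2) 0 hz le_rfl
  rw [sub_zero, abs_of_nonneg hz] at h1
  have h2 := (le_abs_self _).trans h1
  have h3 := gf_le_self H.h1 (div_nonneg hw hm.le : 0 ≤ η (s ^ k / 2) / s ^ m)
  have h4 := hN.2
  have h5 := H.div_pow_le_self' (by linarith : 0 ≤ 2 * ε) m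
  have h6 : 1 / 4 ≤ GG s m (η (s ^ k / 2)) := by
    rw [abs_lt] at h4; linarith [H.h2]
  have h7 : 1 / 4 ≤ η (s ^ k / 2) / s ^ m := h6.trans h3
  rw [le_div_iff₀ hm] at h7
  by_contra hcon
  push Not at hcon
  have h8 : s ^ (k + C) ≤ s ^ m := pow_le_pow_right₀ H.h1.le hcon.le
  rw [pow_add] at h8
  have h9 : 4 * (η 0 + 2 * A) * s ^ k < s ^ C * s ^ k := by gcongr
  have h10 : η 0 ≤ η 0 * s ^ k := le_mul_of_one_le_right h00 hk1
  have h11 : A * (s ^ k / 2 + 1) ≤ 2 * A * s ^ k := by nlinarith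
  nlinarith

lemma near_low (H : Hyp s d) (P : GPair s η θ) {ε : ℝ} (hε : 0 < ε) (hεd : 8 * ε < d)
    (hε2 : 5 * ε < (s - 1) * (1 - s / 2)) : ∃ k0 : ℕ, ∃ C > 0, ∀ k ≥ k0, ∀ m, Near s η ε k m →
      η (s ^ k / 2) - η (s ^ k * (1 - s / 2)) < C * s ^ m := by
  have hs := H.s0
  have hd := H.d_le
  obtain ⟨M, δ, hδ, hM⟩ := P.g1.uc ε hε
  obtain ⟨C, hC, hcov⟩ := H.cov
  refine ⟨M + 1, C * s + 1, by positivity, fun k hk m hN => ?_⟩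
  obtain ⟨j, rfl⟩ : ∃ j, k = j + 1 := ⟨k - 1, by omega⟩
  have hp : 0 < s ^ (j + 1) := pow_pos H.s0 _
  have hm : 0 < s ^ m := pow_pos H.s0 _
  by_contra hcon
  push Not at hcon
  set p := s ^ (j + 1) / 2 with hp_def
  set U := s ^ (j + 1) * (s - 1) / 2 with hU_def
  have hU : 0 ≤ U := by have := H.h1; rw [hU_def]; have : 0 ≤ s - 1 := by linarith
                        positivity
  have hUp : U ≤ p := by rw [hU_def, hp_def]; nlinarith [H.h2]
  have hpU : s ^ (j + 1) * (1 - s / 2) = p - U := by rw [hU_def, hp_def]; ring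
  rw [hpU] at hcon
  obtain ⟨c1, c2, c3, c4⟩ := arms P.g1 hUp
  have h0 := H.arms_h0 hUp hδ hM (H.symm_std j) (by omega)
  set w := η p with hw_def
  have hbU := P.g1.pos (p - U) (by linarith)
  obtain ⟨t0, ht0, hgt⟩ := hcov ((w - C * s * s ^ m) / s ^ (m + 1)) (div_nonneg (by nlinarith)
    (by positivity))
  set t := t0 * s ^ (m + 1) with ht_def
  have hm1 : 0 < s ^ (m + 1) := pow_pos H.s0 _
  have ht1 : w - C * s * s ^ m ≤ t := by
    have := ht0.1; rw [div_le_iff₀ hm1] at this; exact this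
  have ht2 : t ≤ w := by
    have := ht0.2
    rw [← sub_le_iff_le_add, le_div_iff₀ hm1] at this
    have e : C * s ^ (m + 1) = C * s * s ^ m := by ring
    nlinarith
  have hGt1 : GG s (m + 1) t = 1 / 2 := by
    unfold GG
    rw [ht_def, mul_div_assoc, div_self hm1.ne', mul_one]; exact hgt
  have hGt : GG s m t = s / 2 := by
    rw [GG_succ H.h1, hGt1, tent_left hs.le le_rfl]; ring
  have hiv := intermediate_value_Icc' hU c2
  simp only [sub_zero] at hiv
  obtain ⟨us, hus, hbs⟩ := hiv (⟨by nlinarith, ht2⟩ : t ∈ Icc (η (p - U)) (η p))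
  simp only at hbs
  have sub : Icc 0 us ⊆ Icc 0 U := Icc_subset_Icc_right hus.2
  have hstart : ∀ n, n ≠ m → 2 * ε / s ^ n ≤ |GG s n w - 1 / 2| := by
    intro n hn
    by_contra hc
    push Not at hc
    exact hn (H.uniq (by linarith) (by linarith) (by linarith : 2 * ε + 2 * ε < d) hc.le hN.2.le)
  have hPs : ∀ n, n ≠ m → PP s ε (fun u => η (p + u)) (fun u => η (p - u)) us n := by
    intro n hn
    refine PP_of_start H hε hus.1 (by simp) ?_
    simpa using hstart n hn
  have hrun := fun m' h => H.run hε hεd (c1.mono sub) (c2.mono sub) (c3.mono sub) (c4.mono sub)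
    (fun u hu => h0 u (sub hu)) m' h
  have hE := hrun m (fun n _ hn => hPs n (by omega))
  obtain ⟨i, rfl⟩ : ∃ i, m = i + 1 := ⟨m - 1, by have := hN.1; omega⟩
  have hEi := Hyp.EE.le H hε (hE i (by omega)) us ⟨hus.1, le_rfl⟩
  have hsd := H.GG_sides i _ _ hEi
  have ha_ge : w ≤ η (p + us) :=
    P.g1.mono.monotoneOn (show 0 ≤ p by linarith) (show 0 ≤ p + us by linarith [hus.1])
      (by linarith [hus.1])
  rw [hbs, hGt, abs_of_nonneg (by linarith [H.h1] : 0 ≤ s / 2 - 1 / 2)] at hsd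
  have hsd2 := hsd.trans (H.div_pow_le_self' (by linarith : 0 ≤ 5 * ε) (i + 1))
  have hw1 : (C * s + 1) * s ^ (i + 1) ≤ w := by linarith
  have hcore : s * (1 - s / 2) ≤ GG s (i + 1) (η (p + us)) := by
    apply gf_core H.h1 H.h2
    rw [le_div_iff₀ hm]
    have : s * (1 - s / 2) ≤ C * s + 1 := by nlinarith [mul_pos hC hs, sq_nonneg (s - 1)]
    calc s * (1 - s / 2) * s ^ (i + 1) ≤ (C * s + 1) * s ^ (i + 1) := by gcongr
      _ ≤ _ := by linarith
  have hgt2 : 1 / 2 ≤ GG s (i + 1) (η (p + us)) := by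
    by_contra hc
    push Not at hc
    rw [abs_of_neg (by linarith : GG s (i + 1) (η (p + us)) - 1 / 2 < 0), abs_le] at hsd2
    nlinarith
  rw [abs_of_nonneg (by linarith : 0 ≤ GG s (i + 1) (η (p + us)) - 1 / 2), abs_le] at hsd2
  have hPm : PP s ε (fun u => η (p + u)) (fun u => η (p - u)) us (i + 1) := by
    refine ⟨us, ⟨hus.1, le_rfl⟩, ?_, ?_⟩
    · refine (H.div_pow_le_self' (by linarith) _).trans ?_
      simp only
      rw [abs_of_nonneg (by linarith)]
      linarith
    · simp only
      rw [hbs, hGt]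
      apply mul_pos <;> linarith
  have hall : ∀ n, EE s ε (fun u => η (p + u)) (fun u => η (p - u)) us n := by
    intro n
    refine hrun (n + 1) (fun l _ _ => ?_) n (by omega)
    by_cases hl : l = i + 1
    · rw [hl]; exact hPm
    · exact hPs l hl
  have hfin := H.run_all hε hall us ⟨hus.1, le_rfl⟩
  rw [hbs, abs_le] at hfin
  have h5 := GG_lip' H.h1 (i + 1) t w
  rw [hGt, abs_of_nonpos (by linarith : t - w ≤ 0)] at h5
  have h6 := hN.2.le.trans (H.div_pow_le_self' (by linarith : 0 ≤ 2 * ε) (i + 1))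
  rw [abs_le] at h5 h6
  linarith [h5.1, h5.2, h6.1, h6.2]

lemma near_tendsto (H : Hyp s d) (P : GPair s η θ) {ε : ℝ} (hε : 0 < ε) (hεd : 8 * ε < d)
    (hε2 : 5 * ε < (s - 1) * (1 - s / 2)) (N : ℕ) : ∃ k0 : ℕ, ∀ k ≥ k0, ∀ m, Near s η ε k m →
      N ≤ m := by
  obtain ⟨k0, C, hC, h⟩ := H.near_low P hε hεd hε2
  obtain ⟨A, hA, hlow⟩ := H.coarse_low P
  have hs1 : 0 < s - 1 := by linarith [H.h1]
  have hs2 : 0 < 2 - s := by linarith [H.h2]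
  obtain ⟨k1, hk1⟩ := H.pow_large (A * (C * s ^ N + 1) * 2 / (s - 1))
  refine ⟨max k0 k1, fun k hk m hN => ?_⟩
  by_contra hc
  push Not at hc
  have h1 := h k (by omega) m hN
  have h2 := hk1 k (by omega)
  rw [div_lt_iff₀ hs1] at h2
  have hp : 0 < s ^ k := pow_pos H.s0 _
  have h00 : 0 ≤ s ^ k * (1 - s / 2) := by
    have : 0 ≤ 1 - s / 2 := by linarith
    positivity
  have h01 : 0 ≤ s ^ k / 2 := by positivity
  have h3 := hlow (s ^ k / 2) (s ^ k * (1 - s / 2)) h01 h00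
  have h4 : s ^ k * (1 - s / 2) ≤ s ^ k / 2 := by nlinarith
  have h5 : η (s ^ k * (1 - s / 2)) ≤ η (s ^ k / 2) := P.g1.mono.monotoneOn h00 h01 h4
  rw [abs_of_nonneg (by linarith), abs_of_nonneg (by linarith)] at h3
  have h6 : C * s ^ m ≤ C * s ^ N :=
    mul_le_mul_of_nonneg_left (pow_le_pow_right₀ H.h1.le hc.le) hC.le
  have h7 : A * (η (s ^ k / 2) - η (s ^ k * (1 - s / 2)) + 1) ≤ A * (C * s ^ N + 1) :=
    mul_le_mul_of_nonneg_left (by linarith) hA.le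
  nlinarith

end Hyp

namespace Hyp
variable {s d : ℝ} {η θ : ℝ → ℝ}

lemma near_incr (H : Hyp s d) (P : GPair s η θ) : ∃ ε > 0, 8 * ε < d ∧ ∃ k0 : ℕ,
    ∀ k ≥ k0, ∀ m m', Near s η ε k m → Near s η ε (k + 1) m' → m < m' := by
  have hs := H.s0
  have hd := H.hd
  have hs1 : 0 < s - 1 := by linarith [H.h1]
  have hs2 : 0 < 1 - s / 2 := by linarith [H.h2]
  obtain ⟨δθ, hδθ, hlc⟩ := H.lc P.g2 (ε := d / 4) (by linarith)
  obtain ⟨ε, hε, hε1, hε2, hε3⟩ : ∃ ε > 0, 32 * ε ≤ d ∧ 10 * ε ≤ (s - 1) * (1 - s / 2) ∧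
      7 * ε ≤ δθ := by
    refine ⟨min (d / 32) (min ((s - 1) * (1 - s / 2) / 10) (δθ / 7)), by positivity, ?_, ?_, ?_⟩
    · linarith [min_le_left (d / 32) (min ((s - 1) * (1 - s / 2) / 10) (δθ / 7))]
    · linarith [min_le_right (d / 32) (min ((s - 1) * (1 - s / 2) / 10) (δθ / 7)),
        min_le_left ((s - 1) * (1 - s / 2) / 10) (δθ / 7)]
    · linarith [min_le_right (d / 32) (min ((s - 1) * (1 - s / 2) / 10) (δθ / 7)),
        min_le_right ((s - 1) * (1 - s / 2) / 10) (δθ / 7)]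
  refine ⟨ε, hε, by linarith, ?_⟩
  obtain ⟨M, δ, hδ, hM⟩ := P.g1.uc ε hε
  obtain ⟨Mθ, L, hfold⟩ := H.fold_near P.symm hε (by linarith)
  obtain ⟨N, hN⟩ := H.pow_large (2 * L / d)
  obtain ⟨k1, hk1⟩ := H.near_tendsto P hε (by linarith) (by linarith) (max N (Mθ + 1))
  refine ⟨max k1 (M + 1), fun k hk m m' hm hm' => ?_⟩
  by_contra hcon
  push Not at hcon
  have hm'N := hk1 (k + 1) (by omega) m' hm'
  obtain ⟨j, rfl⟩ : ∃ j, k = j + 1 := ⟨k - 1, by omega⟩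
  obtain ⟨i, rfl⟩ : ∃ i, m' = i + 1 := ⟨m' - 1, by omega⟩
  have hp : 0 < s ^ (j + 1) := pow_pos H.s0 _
  set p := s ^ (j + 1) / 2 with hp_def
  set U := s ^ (j + 1) * (s - 1) / 2 with hU_def
  have hU : 0 ≤ U := by positivity
  have hUp : U ≤ p := by rw [hU_def, hp_def]; nlinarith [H.h2]
  have hpU : s ^ (j + 1) * (1 - s / 2) = p - U := by rw [hU_def, hp_def]; ring
  have hpU2 : s ^ (j + 1 + 1) / 2 = p + U := by rw [hU_def, hp_def]; ring
  obtain ⟨c1, c2, c3, c4⟩ := arms P.g1 hUp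
  have h0 := H.arms_h0 hUp hδ hM (H.symm_std j) (by omega)
  have hE := H.run hε (by linarith) c1 c2 c3 c4 h0 (i + 1) (by
    intro n _ hn
    refine PP_of_start H hε hU (by simp) ?_
    by_contra hc
    push Not at hc
    rw [add_zero] at hc
    have := H.uniq (by linarith) (by linarith) (by linarith : 2 * ε + 2 * ε < d) hc.le hm.2.le
    omega)
  have hEi := Hyp.EE.le H hε (hE i (by omega)) U ⟨hU, le_rfl⟩
  have hsd := H.GG_sides i _ _ hEi
  have hnear := hm'.2.le
  rw [hpU2] at hnear
  have hi : 0 < s ^ (i + 1) := pow_pos hs _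
  have hv : |GG s (i + 1) (η (p - U)) - 1 / 2| ≤ 7 * ε / s ^ (i + 1) := by
    have e : 7 * ε / s ^ (i + 1) = 5 * ε / s ^ (i + 1) + 2 * ε / s ^ (i + 1) := by ring
    rw [abs_le] at hsd
    linarith [hsd.1]
  obtain ⟨q, hq1, hq2⟩ := H.exact_near (by linarith) (by linarith) hv
  have hqh : 1 / 2 ≤ q / s ^ (i + 1) := by
    by_contra hc
    push Not at hc
    unfold GG at hq2
    rw [gf_small H.h1 (by linarith [H.h1])] at hq2
    linarith
  rw [le_div_iff₀ hi] at hqh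
  have hd1 := H.d_le
  have hNp := hN (i + 1) (by omega)
  rw [div_lt_iff₀ hd] at hNp
  obtain ⟨m2, -, hm2⟩ := hfold q (d / 2 * s ^ (i + 1)) (by positivity)
    (by nlinarith [H.h2]) (by linarith) i (by omega) (H.symm_near hq2)
  have hq0 : 0 ≤ q := by nlinarith
  have hl := hlc q (η (p - U)) hq0 (P.g1.pos _ (by linarith)) (by linarith)
  rw [P.i1 _ (by linarith)] at hl
  have hcr := H.crit (j + 1) m2
  rw [hpU] at hcr
  have k1 := GG_lip' H.h1 m2 (p - U) (θ q)
  have k2 := hm2.le.trans (H.div_pow_le_self' (by linarith : 0 ≤ 2 * ε) m2)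
  have k3 := abs_sub_le (GG s m2 (p - U)) (GG s m2 (θ q)) (1 / 2)
  rw [abs_sub_comm] at hl
  linarith

lemma main (H : Hyp s d) (P : GPair s η θ) : ∃ b : ℤ, ∀ ε > 0, ∃ k1 : ℕ, ∀ k ≥ k1,
    ∃ m : ℕ, (m : ℤ) = k + b ∧ |GG s m (η (s ^ k / 2)) - 1 / 2| < 2 * ε / s ^ m := by
  have hd := H.hd
  obtain ⟨ε, hε, hεd, k0, hinc⟩ := H.near_incr P
  obtain ⟨k1, hex⟩ := H.near_exists P hε hεd
  obtain ⟨C, hup⟩ := H.near_upper P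
  have : ∀ k, ∃ m, k1 ≤ k → Near s η ε k m := by
    intro k
    by_cases hk : k1 ≤ k
    · obtain ⟨m, hm⟩ := hex k hk; exact ⟨m, fun _ => hm⟩
    · exact ⟨0, fun h => absurd h hk⟩
  choose m hm using this
  set K := max k0 k1 with hK
  have hstep : ∀ k ≥ K, m k < m (k + 1) := fun k hk =>
    hinc k (by omega) _ _ (hm k (by omega)) (hm (k + 1) (by omega))
  have hupk : ∀ k ≥ K, m k ≤ k + C := fun k hk => hup ε hε hεd k _ (hm k (by omega))
  obtain ⟨r, ⟨k2, hk2, hr⟩, hmin⟩ : ∃ r, (∃ k ≥ K, k + C - m k = r) ∧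
      ∀ r', (∃ k ≥ K, k + C - m k = r') → r ≤ r' := by
    classical
    have hex : ∃ r, ∃ k ≥ K, k + C - m k = r := ⟨_, K, le_rfl, rfl⟩
    exact ⟨Nat.find hex, Nat.find_spec hex, fun r' h => Nat.find_min' hex h⟩
  have hconst : ∀ k ≥ k2, k + C - m k = r := by
    intro k hk
    induction k, hk using Nat.le_induction with
    | base => exact hr
    | succ k hk ih =>
      have h1 := hstep k (by omega)
      have h2 := hupk (k + 1) (by omega)
      have h3 := hmin _ ⟨k + 1, by omega, rfl⟩
      omega
  refine ⟨C - r, fun ε' hε' => ?_⟩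
  obtain ⟨k3, hex3⟩ := H.near_exists P (ε := min ε' (d / 16)) (by positivity)
    (by linarith [min_le_right ε' (d / 16)])
  refine ⟨max k2 k3, fun k hk => ⟨m k, ?_, ?_⟩⟩
  · have h1 := hconst k (by omega)
    have h2 := hupk k (by omega)
    omega
  · obtain ⟨m', hm'⟩ := hex3 k (by omega)
    have := H.Near_uniq (by positivity) hε (by linarith [min_le_right ε' (d / 16)]) hm'
      (hm k (by omega))
    subst this
    refine hm'.2.trans_le ?_
    have := H.s0
    have := min_le_left ε' (d / 16)
    gcongr

end Hyp

lemma exists_hyp (s : ℝ) (hs1 : Real.sqrt 2 < s) (hs2 : s < 2)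
    (hnr : (1 : ℝ) / 2 ∉ omegaSet (tent s) (1 / 2)) : ∃ d, Hyp s d := by
  have hsq : 2 < s ^ 2 := by
    have h1 := Real.sq_sqrt (show (0 : ℝ) ≤ 2 by norm_num)
    have h2 := Real.sqrt_nonneg 2
    nlinarith
  have h1 : 1 < s := by
    have h2 := Real.sqrt_nonneg 2
    nlinarith
  have hne : ∀ i, 1 ≤ i → (tent s)^[i] (1 / 2) ≠ 1 / 2 := by
    intro i hi h
    refine hnr ⟨fun k => i * k, fun a b hab => Nat.mul_lt_mul_of_pos_left hab hi, ?_⟩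
    have : ∀ k, (tent s)^[i * k] (1 / 2) = 1 / 2 := by
      intro k
      rw [iterate_mul]
      exact iterate_fixed h k
    simp only [this]
    exact tendsto_const_nhds
  have hcl : ¬ MapClusterPt ((1 : ℝ) / 2) atTop (fun n => (tent s)^[n] (1 / 2)) := by
    intro h
    obtain ⟨ψ, hψ, ht⟩ := MapClusterPt.tendsto_subseq h
    exact hnr ⟨ψ, hψ, ht⟩
  rw [mapClusterPt_iff_frequently] at hcl
  push Not at hcl
  obtain ⟨V, hV, hev⟩ := hcl
  obtain ⟨r, hr, hrV⟩ := Metric.mem_nhds_iff.1 hV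
  obtain ⟨N, hN⟩ := eventually_atTop.1 hev
  have hfin : ∀ N : ℕ, ∃ d > 0, ∀ i, 1 ≤ i → i < N → d ≤ |(tent s)^[i] (1 / 2) - 1 / 2| := by
    intro N
    induction N with
    | zero => exact ⟨1, one_pos, fun i _ h => by omega⟩
    | succ N ih =>
      obtain ⟨d, hd, h⟩ := ih
      by_cases hN : 1 ≤ N
      · refine ⟨min d |(tent s)^[N] (1 / 2) - 1 / 2|,
          lt_min hd (abs_pos.2 (sub_ne_zero.2 (hne N hN))), fun i hi hiN => ?_⟩
        rcases Nat.lt_succ_iff_lt_or_eq.1 hiN with c | c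
        · exact (min_le_left _ _).trans (h i hi c)
        · rw [c]; exact min_le_right _ _
      · exact ⟨1, one_pos, fun i _ h => by omega⟩
  obtain ⟨d, hd, hdN⟩ := hfin N
  refine ⟨min d r, h1, hs2, hsq, lt_min hd hr, fun i hi => ?_⟩
  rcases lt_or_ge i N with c | c
  · exact (min_le_left _ _).trans (hdN i hi c)
  · refine (min_le_right _ _).trans ?_
    by_contra hcon
    push Not at hcon
    exact hN i c (hrV (by rw [Metric.mem_ball, Real.dist_eq]; exact hcon))

/-- The parametrisation of the composant of `0` . -/
def Phi (s : ℝ) (h1 : 1 < s) (h2 : s < 2) (t : ℝ) : invLim s :=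
  ⟨fun n => GG s n (max t 0), fun n =>
    ⟨gf_nonneg h1 h2 _ (div_nonneg (le_max_right _ _) (by positivity)),
      (gf_le h1 _).trans (by linarith)⟩, fun n => GG_succ h1 n _⟩

section Top
variable {s : ℝ} (h1 : 1 < s) (h2 : s < 2)

lemma Phi_apply {t : ℝ} (ht : 0 ≤ t) (n : ℕ) : (Phi s h1 h2 t).1 n = GG s n t := by
  simp only [Phi, max_eq_left ht]

lemma Phi_cont : Continuous (Phi s h1 h2) := by
  refine Continuous.subtype_mk (continuous_pi fun n => ?_) _
  exact (GG_cont h1 n).comp (by fun_prop)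

lemma x_iter (x : invLim s) (i j : ℕ) : x.1 i = (tent s)^[j] (x.1 (i + j)) := by
  induction j with
  | zero => rfl
  | succ j ih => rw [ih, x.2.2 (i + j), ← iterate_succ_apply]; rfl

lemma x_ext {x y : invLim s} {n : ℕ} (h : ∀ k, x.1 (n + k) = y.1 (n + k)) : x = y := by
  apply Subtype.ext
  funext i
  rw [x_iter x i n, x_iter y i n, add_comm i n, h i]

lemma x_le (h1 : 1 < s) (x : invLim s) (n : ℕ) : x.1 n ≤ s / 2 := by
  rw [x.2.2 n]; exact tent_le (by linarith) _

def CC (s : ℝ) : Set (invLim s) := {x | ∃ n, x.1 n < s * (1 - s / 2)}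

lemma coord_cont (n : ℕ) : Continuous (fun x : invLim s => x.1 n) :=
  (continuous_apply n).comp continuous_subtype_val

lemma CC_open : IsOpen (CC s) := by
  have : CC s = ⋃ n, {x : invLim s | x.1 n < s * (1 - s / 2)} := by
    ext x; simp [CC]
  rw [this]
  exact isOpen_iUnion fun n => isOpen_lt (coord_cont n) continuous_const

lemma c2_lt (h1 : 1 < s) : s * (1 - s / 2) < 1 / 2 := by nlinarith [sq_nonneg (s - 1)]

lemma CC_rep {x : invLim s} {n : ℕ} (h : x.1 n < s * (1 - s / 2)) :
    x = Phi s h1 h2 (s ^ n * x.1 n) := by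
  have hs : 0 < s := by linarith
  have hc := c2_lt h1
  have h0 := (x.2.1 n).1
  have key : ∀ k, x.1 (n + k) = x.1 n / s ^ k := by
    intro k
    induction k with
    | zero => simp
    | succ k ih =>
      have e := x.2.2 (n + k)
      have hlt : x.1 (n + k) < s * (1 - s / 2) := by
        rw [ih]; exact (div_le_self h0 (one_le_pow₀ h1.le)).trans_lt h
      have hle : x.1 (n + k + 1) ≤ 1 / 2 := by
        by_contra hcon
        push Not at hcon
        rw [tent_right hs.le hcon.le] at e
        have := x_le h1 x (n + k + 1)
        nlinarith
      rw [tent_left hs.le hle, ih] at e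
      rw [← add_assoc, pow_succ, ← div_div, e]
      field_simp
  refine x_ext (n := n) fun k => ?_
  rw [key, Phi_apply h1 h2 (by positivity)]
  unfold GG
  have e : s ^ n * x.1 n / s ^ (n + k) = x.1 n / s ^ k := by rw [pow_add]; field_simp
  rw [e, gf_small h1]
  exact (div_le_self h0 (one_le_pow₀ h1.le)).trans (by linarith)

lemma Phi_mem (t : ℝ) : Phi s h1 h2 t ∈ CC s := by
  have hc : 0 < s * (1 - s / 2) := mul_pos (by linarith) (by linarith)
  obtain ⟨k, hk⟩ := exists_div_pow_lt h1 (max t 0) hc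
  refine ⟨k, ?_⟩
  change gf s (max t 0 / s ^ k) < _
  rw [gf_small h1 (by linarith [c2_lt h1])]
  exact hk

lemma Phi_inj {t u : ℝ} (ht : 0 ≤ t) (hu : 0 ≤ u) (h : Phi s h1 h2 t = Phi s h1 h2 u) : t = u := by
  obtain ⟨k, hk⟩ := exists_div_pow_le h1 t
  obtain ⟨l, hl⟩ := exists_div_pow_le h1 u
  have hk' := div_pow_le_of_le h1 (by norm_num) (le_max_left k l) hk
  have hl' := div_pow_le_of_le h1 (by norm_num) (le_max_right k l) hl
  have e : (Phi s h1 h2 t).1 (max k l) = (Phi s h1 h2 u).1 (max k l) := by rw [h]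
  rw [Phi_apply h1 h2 ht, Phi_apply h1 h2 hu] at e
  unfold GG at e
  rw [gf_small h1 (by linarith), gf_small h1 (by linarith)] at e
  have hs : s ^ (max k l) ≠ 0 := by positivity
  field_simp at e
  exact e

lemma CC_exists {x : invLim s} (h : x ∈ CC s) : ∃ t, 0 ≤ t ∧ x = Phi s h1 h2 t := by
  obtain ⟨n, hn⟩ := h
  have := (x.2.1 n).1
  exact ⟨s ^ n * x.1 n, by positivity, CC_rep h1 h2 hn⟩

lemma Phi_dense : DenseRange (Phi s h1 h2) := by
  intro x
  refine mem_closure_of_tendsto (f := fun n => Phi s h1 h2 (s ^ n * x.1 n)) (b := atTop) ?_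
    (Eventually.of_forall fun n => mem_range_self _)
  rw [tendsto_subtype_rng, tendsto_pi_nhds]
  intro i
  refine tendsto_const_nhds.congr' ?_
  filter_upwards [eventually_ge_atTop i] with n hn
  obtain ⟨j, rfl⟩ := Nat.exists_eq_add_of_le hn
  have := (x.2.1 (i + j)).1
  rw [Phi_apply h1 h2 (by positivity), GG_iter h1 i j]
  unfold GG
  have hs : s ^ (i + j) ≠ 0 := by positivity
  rw [mul_div_assoc, mul_div_cancel₀ _ hs, gf_small h1 (x_le h1 x _)]
  exact x_iter x i j

lemma lift_cont {γ : ℝ → invLim s} {J : Set ℝ} (hγ : ContinuousOn γ J) {f : ℝ → ℝ}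
    (hf : ∀ t ∈ J, 0 ≤ f t ∧ γ t = Phi s h1 h2 (f t)) : ContinuousOn f J := by
  intro t0 ht0
  obtain ⟨n, hn⟩ : γ t0 ∈ CC s := by rw [(hf t0 ht0).2]; exact Phi_mem h1 h2 _
  have hc : ContinuousWithinAt (fun t => (γ t).1 n) J t0 :=
    (coord_cont n).continuousAt.comp_continuousWithinAt (hγ t0 ht0)
  have hloc : ∀ t ∈ J, (γ t).1 n < s * (1 - s / 2) → f t = s ^ n * (γ t).1 n := by
    intro t ht hlt
    have h0 := ((γ t).2.1 n).1
    refine Phi_inj h1 h2 (hf t ht).1 (by positivity) ?_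
    rw [← CC_rep h1 h2 hlt, ← (hf t ht).2]
  have hcm : ContinuousWithinAt (fun t => s ^ n * (γ t).1 n) J t0 :=
    continuousWithinAt_const.mul hc
  refine hcm.congr_of_eventuallyEq ?_ (hloc t0 ht0 hn)
  filter_upwards [hc.eventually (gt_mem_nhds hn), self_mem_nhdsWithin] with t h1 h2
  exact hloc t h2 h1

lemma path_fwd (h1 : 1 < s) (h2 : s < 2) {d : ℝ} (H : Hyp s d) {γ : ℝ → invLim s} (hγ : Continuous γ) {a b : ℝ} (hab : a ≤ b)
    (ha : γ a ∈ CC s) : γ b ∈ CC s := by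
  by_contra hb
  have hc2 : 0 < s * (1 - s / 2) := mul_pos H.s0 (by linarith)
  have hcpt : IsCompact (Icc a b ∩ γ ⁻¹' (CC s)ᶜ) :=
    isCompact_Icc.inter_right (CC_open.isClosed_compl.preimage hγ)
  obtain ⟨T, ⟨hT1, hT2⟩, hleast⟩ := hcpt.exists_isLeast ⟨b, ⟨hab, le_rfl⟩, hb⟩
  have haT : a < T := lt_of_le_of_ne hT1.1 (by rintro rfl; exact hT2 ha)
  have hin : ∀ t ∈ Ico a T, γ t ∈ CC s := by
    intro t ht
    by_contra hcon
    exact absurd (hleast ⟨⟨ht.1, ht.2.le.trans hT1.2⟩, hcon⟩) (not_le.2 ht.2)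
  have hex : ∀ t, ∃ u, t ∈ Ico a T → 0 ≤ u ∧ γ t = Phi s h1 h2 u := by
    intro t
    by_cases ht : t ∈ Ico a T
    · obtain ⟨u, hu⟩ := CC_exists h1 h2 (hin t ht); exact ⟨u, fun _ => hu⟩
    · exact ⟨0, fun h => absurd h ht⟩
  choose f hf using hex
  have hfc : ContinuousOn f (Ico a T) := lift_cont h1 h2 hγ.continuousOn hf
  have hcc : ∀ n, Continuous fun t => (γ t).1 n := fun n => (coord_cont n).comp hγ
  have hd := H.hd
  obtain ⟨δ, hδ, hδc⟩ := Metric.continuous_iff.1 (hcc 0) T (d / 3) (by linarith)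
  obtain ⟨t1, ht1, ht1T⟩ : ∃ t1 ∈ Ico a T, T - δ < t1 :=
    ⟨max a (T - δ / 2), ⟨le_max_left _ _, max_lt haT (by linarith)⟩,
      lt_max_of_lt_right (by linarith)⟩
  have hosc : ∀ t ∈ Ico t1 T, |(γ t).1 0 - (γ T).1 0| < d / 3 := by
    intro t ht
    have := hδc t (by rw [Real.dist_eq, abs_lt]; constructor <;> linarith [ht.1, ht.2])
    rwa [Real.dist_eq] at this
  have hsub : Ico t1 T ⊆ Ico a T := Ico_subset_Ico_left ht1.1
  obtain ⟨t2, ht2, hbig⟩ : ∃ t2 ∈ Ico t1 T, f t1 + 2 * d < f t2 := by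
    by_contra hcon
    push Not at hcon
    obtain ⟨n, hn⟩ := exists_div_pow_lt h1 (f t1 + 2 * d) (half_pos hc2)
    have hpn : 0 < s ^ n := pow_pos H.s0 n
    have hle : ∀ t ∈ Ico t1 T, (γ t).1 n ≤ s * (1 - s / 2) / 2 := by
      intro t ht
      obtain ⟨h0, e⟩ := hf t (hsub ht)
      rw [e, Phi_apply h1 h2 h0]
      have k1 : f t / s ^ n ≤ (f t1 + 2 * d) / s ^ n :=
        div_le_div_of_nonneg_right (hcon t ht) hpn.le
      exact (gf_le_self h1 (div_nonneg h0 hpn.le)).trans (by linarith)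
    have hlim : (γ T).1 n ≤ s * (1 - s / 2) / 2 := by
      have htd : Tendsto (fun t => (γ t).1 n) (𝓝[<] T) (𝓝 ((γ T).1 n)) :=
        ((hcc n).tendsto T).mono_left nhdsWithin_le_nhds
      refine le_of_tendsto htd ?_
      filter_upwards [Ico_mem_nhdsLT ht1.2] with t ht
      exact hle t ht
    exact hT2 ⟨n, by linarith⟩
  have hiv := intermediate_value_Icc ht2.1 (hfc.mono fun t ht =>
    (⟨ht1.1.trans ht.1, ht.2.trans_lt ht2.2⟩ : t ∈ Ico a T))
  obtain ⟨v, hv, v', hv', hl⟩ := H.len (x := f t1) (y := f t1 + 2 * d) (by linarith)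
  rw [show (f t1 + 2 * d - f t1) / 2 = d by ring, min_self] at hl
  obtain ⟨u, hu, rfl⟩ := hiv (⟨hv.1, hv.2.trans hbig.le⟩ : v ∈ Icc (f t1) (f t2))
  obtain ⟨u', hu', rfl⟩ := hiv (⟨hv'.1, hv'.2.trans hbig.le⟩ : v' ∈ Icc (f t1) (f t2))
  have hg : ∀ t ∈ Icc t1 t2, (γ t).1 0 = gf s (f t) := by
    intro t ht
    obtain ⟨h0, e⟩ := hf t ⟨ht1.1.trans ht.1, ht.2.trans_lt ht2.2⟩
    rw [e, Phi_apply h1 h2 h0, GG_zero]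
  have o1 := hosc u ⟨hu.1, hu.2.trans_lt ht2.2⟩
  have o2 := hosc u' ⟨hu'.1, hu'.2.trans_lt ht2.2⟩
  rw [hg u hu] at o1
  rw [hg u' hu'] at o2
  have := abs_sub_le (gf s (f u)) ((γ T).1 0) (gf s (f u'))
  rw [abs_sub_comm ((γ T).1 0)] at this
  linarith

lemma path_all (h1 : 1 < s) (h2 : s < 2) {d : ℝ} (H : Hyp s d) {γ : ℝ → invLim s} (hγ : Continuous γ) {a : ℝ}
    (ha : γ a ∈ CC s) (b : ℝ) : γ b ∈ CC s := by
  rcases le_total a b with c | c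
  · exact path_fwd h1 h2 H hγ c ha
  · have := path_fwd h1 h2 H (γ := fun t => γ (-t)) (hγ.comp continuous_neg) (neg_le_neg c)
      (by simpa using ha)
    simpa using this

lemma lift_exists {d : ℝ} (H : Hyp s d) (h : invLim s ≃ₜ invLim s) (t : ℝ) :
    ∃ u, 0 ≤ u ∧ h (Phi s h1 h2 t) = Phi s h1 h2 u := by
  have hopen : IsOpen (h ⁻¹' CC s) := CC_open.preimage h.continuous
  obtain ⟨t0, ht0⟩ := (Phi_dense h1 h2).exists_mem_open hopen
    ⟨h.symm (Phi s h1 h2 0), by simpa using Phi_mem h1 h2 0⟩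
  exact CC_exists h1 h2 (path_all h1 h2 H (γ := fun t => h (Phi s h1 h2 t))
    (h.continuous.comp (Phi_cont h1 h2)) ht0 t)

end Top

section Lift
variable {s d : ℝ}

lemma invLim_compact (s : ℝ) : CompactSpace (invLim s) := by
  rw [← isCompact_iff_compactSpace]
  have e : invLim s = (univ.pi fun _ : ℕ => Icc (0 : ℝ) 1) ∩
      ⋂ n, {x : ℕ → ℝ | x n = tent s (x (n + 1))} := by
    ext x
    simp only [invLim, mem_inter_iff, mem_univ_pi, mem_iInter]
    rfl
  rw [e]
  refine (isCompact_univ_pi fun _ => isCompact_Icc).inter_right (isClosed_iInter fun n => ?_)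
  refine isClosed_eq (continuous_apply n) ?_
  unfold tent
  fun_prop

lemma lift_uc (H : Hyp s d) (h : invLim s ≃ₜ invLim s) {η : ℝ → ℝ}
    (hη : ∀ t, 0 ≤ η t ∧ h (Phi s H.h1 H.h2 t) = Phi s H.h1 H.h2 (η t)) :
    ∀ ε > 0, ∃ M : ℕ, ∃ δ > 0, ∀ t t', 0 ≤ t → 0 ≤ t' →
    (∀ n ≤ M, |GG s n t - GG s n t'| ≤ δ) → |gf s (η t) - gf s (η t')| ≤ ε := by
  intro ε hε
  by_contra hcon
  push Not at hcon
  have hsel : ∀ M : ℕ, ∃ t t', 0 ≤ t ∧ 0 ≤ t' ∧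
      (∀ n ≤ M, |GG s n t - GG s n t'| ≤ 1 / ((M : ℝ) + 1)) ∧ ε < |gf s (η t) - gf s (η t')| := by
    intro M
    obtain ⟨t, t', a, b, c, e⟩ := hcon M (1 / ((M : ℝ) + 1)) (by positivity)
    exact ⟨t, t', a, b, c, e⟩
  choose t t' ht ht' hclose hfar using hsel
  have := invLim_compact s
  obtain ⟨a, φ, hφ, hlim⟩ := CompactSpace.tendsto_subseq fun M => Phi s H.h1 H.h2 (t M)
  have hlim' : Tendsto (fun j => Phi s H.h1 H.h2 (t' (φ j))) atTop (𝓝 a) := by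
    rw [tendsto_subtype_rng, tendsto_pi_nhds] at hlim ⊢
    intro n
    have l1 := hlim n
    have l2 : Tendsto (fun j => (Phi s H.h1 H.h2 (t' (φ j))).1 n - (Phi s H.h1 H.h2 (t (φ j))).1 n)
        atTop (𝓝 0) := by
      have l3 : Tendsto (fun j => 1 / ((φ j : ℝ) + 1)) atTop (𝓝 0) :=
        tendsto_one_div_add_atTop_nhds_zero_nat.comp hφ.tendsto_atTop
      refine squeeze_zero_norm' ?_ l3
      filter_upwards [hφ.tendsto_atTop.eventually_ge_atTop n] with j hj
      rw [Phi_apply _ _ (ht _), Phi_apply _ _ (ht' _), Real.norm_eq_abs, abs_sub_comm]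
      exact hclose (φ j) n hj
    simpa using l2.add l1
  have k1 : Tendsto (fun j => (h (Phi s H.h1 H.h2 (t (φ j)))).1 0) atTop (𝓝 ((h a).1 0)) :=
    (((coord_cont 0).comp h.continuous).tendsto a).comp hlim
  have k2 : Tendsto (fun j => (h (Phi s H.h1 H.h2 (t' (φ j)))).1 0) atTop (𝓝 ((h a).1 0)) :=
    (((coord_cont 0).comp h.continuous).tendsto a).comp hlim'
  have k3 := (k1.sub k2).abs
  rw [sub_self, abs_zero] at k3
  obtain ⟨j, hj⟩ := (k3.eventually (gt_mem_nhds hε)).exists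
  rw [(hη _).2, (hη _).2, Phi_apply _ _ (hη _).1, Phi_apply _ _ (hη _).1, GG_zero, GG_zero] at hj
  exact absurd (hfar (φ j)) (not_lt.2 hj.le)

lemma lift_good (H : Hyp s d) (h : invLim s ≃ₜ invLim s) {η θ : ℝ → ℝ}
    (hη : ∀ t, 0 ≤ η t ∧ h (Phi s H.h1 H.h2 t) = Phi s H.h1 H.h2 (η t))
    (hθ : ∀ t, 0 ≤ θ t) (i1 : ∀ t, 0 ≤ t → θ (η t) = t) (i2 : ∀ t, 0 ≤ t → η (θ t) = t) :
    Good s η := by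
  have hc : ContinuousOn η univ := lift_cont H.h1 H.h2
    (γ := fun t => h (Phi s H.h1 H.h2 t)) (h.continuous.comp (Phi_cont H.h1 H.h2)).continuousOn
    (fun t _ => hη t)
  have hinj : InjOn η (Ici 0) := fun x hx y hy e => by rw [← i1 x hx, e, i1 y hy]
  refine ⟨fun t _ => (hη t).1, hc.mono (subset_univ _), ?_, lift_uc H h hη⟩
  intro x hx y hy hxy
  have h00 := (hη 0).1
  have hR1 := le_max_left y (θ (η 0 + 1))
  have hR2 := le_max_right y (θ (η 0 + 1))
  have hx0 : 0 ≤ x := hx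
  have hy0 : 0 ≤ y := hy
  rcases (hc.mono (subset_univ (Icc 0 (max y (θ (η 0 + 1)))))).strictMonoOn_of_injOn_Icc'
    (hy0.trans hR1) (hinj.mono Icc_subset_Ici_self) with c | c
  · exact c ⟨hx0, hxy.le.trans hR1⟩ ⟨hy0, hR1⟩ hxy
  · exfalso
    have := c.antitoneOn ⟨le_rfl, hy0.trans hR1⟩ ⟨hθ (η 0 + 1), hR2⟩ (hθ _)
    rw [i2 _ (by linarith)] at this
    linarith

lemma lift_pair (H : Hyp s d) (h : invLim s ≃ₜ invLim s) : ∃ η θ : ℝ → ℝ, GPair s η θ ∧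
    ∀ t, 0 ≤ η t ∧ h (Phi s H.h1 H.h2 t) = Phi s H.h1 H.h2 (η t) := by
  choose η hη using lift_exists H.h1 H.h2 H h
  choose θ hθ using lift_exists H.h1 H.h2 H h.symm
  have i1 : ∀ t, 0 ≤ t → θ (η t) = t := by
    intro t ht
    refine Phi_inj H.h1 H.h2 (hθ _).1 ht ?_
    rw [← (hθ _).2, ← (hη _).2, h.symm_apply_apply]
  have i2 : ∀ t, 0 ≤ t → η (θ t) = t := by
    intro t ht
    refine Phi_inj H.h1 H.h2 (hη _).1 ht ?_
    rw [← (hη _).2, ← (hθ _).2, h.apply_symm_apply]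
  exact ⟨η, θ, ⟨lift_good H h hη (fun t => (hθ t).1) i1 i2,
    lift_good H h.symm hθ (fun t => (hη t).1) i2 i1, i1, i2⟩, hη⟩

lemma shiftFwd_iter (hs1 : Real.sqrt 2 < s) (hs2 : s < 2) (e n : ℕ) (x : invLim s) :
    ((shiftFwdFun s hs1 hs2)^[e] x).1 n = (tent s)^[e] (x.1 n) := by
  have h0 : ∀ (y : invLim s) n, (shiftFwdFun s hs1 hs2 y).1 n = tent s (y.1 n) := by
    intro y n
    cases n with
    | zero => rfl
    | succ k => exact y.2.2 k
  induction e with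
  | zero => rfl
  | succ e ih => rw [iterate_succ_apply', h0, ih, iterate_succ_apply']

lemma shiftInv_iter (e n : ℕ) (x : invLim s) :
    ((shiftInvFun s)^[e] x).1 n = x.1 (n + e) := by
  induction e generalizing n with
  | zero => rfl
  | succ e ih =>
    rw [iterate_succ_apply']
    change ((shiftInvFun s)^[e] x).1 (n + 1) = _
    rw [ih, Nat.add_right_comm, Nat.add_assoc]

lemma GG_turn (H : Hyp s d) (n j : ℕ) : GG s n (s ^ (n + j) / 2) = (tent s)^[j] (1 / 2) := by
  have hs := H.s0
  rw [GG_iter H.h1 n j]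
  unfold GG
  rw [div_right_comm, div_self (by positivity), gf_small H.h1 (by linarith [H.h1])]

lemma fold_approx (H : Hyp s d) {x : invLim s} (hx : x ∈ foldingPts s) (N : ℕ) :
    ∃ k, N ≤ k ∧ ∀ n ≤ N, |GG s n (s ^ k / 2) - x.1 n| ≤ 1 / ((N : ℝ) + 1) := by
  have hs := H.s0
  obtain ⟨φ, hφ, hlim⟩ := hx N
  have hpos : 0 < 1 / ((N : ℝ) + 1) / s ^ N := by positivity
  obtain ⟨j, hj⟩ := (hlim.eventually (Metric.ball_mem_nhds _ hpos)).exists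
  rw [Real.dist_eq] at hj
  change |(tent s)^[φ j] (1 / 2) - x.1 N| < _ at hj
  refine ⟨N + φ j, by omega, fun n hn => ?_⟩
  obtain ⟨i, rfl⟩ := Nat.exists_eq_add_of_le hn
  rw [GG_iter H.h1 n i, GG_turn H, x_iter x n i]
  refine (tent_iter_lip hs.le _ _ _).trans ?_
  rw [lt_div_iff₀ (by positivity)] at hj
  refine le_trans ?_ hj.le
  rw [mul_comm]
  exact mul_le_mul_of_nonneg_left (pow_le_pow_right₀ H.h1.le (by omega)) (abs_nonneg _)

end Lift

lemma main_limit {s d : ℝ} (H : Hyp s d) (h : invLim s ≃ₜ invLim s) : ∃ b : ℤ,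
    ∀ x ∈ foldingPts s, ∃ k : ℕ → ℕ, Tendsto k atTop atTop ∧
      (∀ n, Tendsto (fun N => GG s n (s ^ (k N) / 2)) atTop (𝓝 (x.1 n))) ∧
      ∀ n : ℕ, Tendsto (fun N => (tent s)^[((k N : ℤ) + b - n).toNat] (1 / 2)) atTop
        (𝓝 ((h x).1 n)) := by
  have hs := H.s0
  obtain ⟨η, θ, P, hη⟩ := lift_pair H h
  obtain ⟨b, hb⟩ := H.main P
  refine ⟨b, fun x hx => ?_⟩
  choose k hk hclose using fold_approx H hx
  have hkt : Tendsto k atTop atTop := tendsto_atTop_mono hk tendsto_id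
  have hcoord : ∀ n, Tendsto (fun N => GG s n (s ^ (k N) / 2)) atTop (𝓝 (x.1 n)) := by
    intro n
    have : Tendsto (fun N => GG s n (s ^ (k N) / 2) - x.1 n) atTop (𝓝 0) := by
      refine squeeze_zero_norm' ?_ tendsto_one_div_add_atTop_nhds_zero_nat
      filter_upwards [eventually_ge_atTop n] with N hN
      exact hclose N n hN
    simpa using this.add_const (x.1 n)
  refine ⟨k, hkt, hcoord, fun n => ?_⟩
  have hz : ∀ N, 0 ≤ s ^ (k N) / 2 := fun N => by positivity
  have hy : Tendsto (fun N => Phi s H.h1 H.h2 (s ^ (k N) / 2)) atTop (𝓝 x) := by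
    rw [tendsto_subtype_rng, tendsto_pi_nhds]
    intro n
    simp only [Phi_apply _ _ (hz _)]
    exact hcoord n
  have hhy : Tendsto (fun N => GG s n (η (s ^ (k N) / 2))) atTop (𝓝 ((h x).1 n)) := by
    have := (((coord_cont n).comp h.continuous).tendsto x).comp hy
    refine this.congr fun N => ?_
    simp only [Function.comp_apply]
    rw [(hη _).2, Phi_apply _ _ (hη _).1]
  have hdiff : Tendsto (fun N => (tent s)^[((k N : ℤ) + b - n).toNat] (1 / 2) -
      GG s n (η (s ^ (k N) / 2))) atTop (𝓝 0) := by
    rw [Metric.tendsto_atTop]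
    intro ε hε
    obtain ⟨k1, hk1⟩ := hb (ε / 4) (by positivity)
    obtain ⟨N0, hN0⟩ := eventually_atTop.1
      (hkt.eventually_ge_atTop (max k1 ((n : ℤ) - b).toNat))
    refine ⟨N0, fun N hN => ?_⟩
    have hkN := hN0 N hN
    obtain ⟨m, hm, hnear⟩ := hk1 (k N) (by omega)
    obtain ⟨j, rfl⟩ : ∃ j, m = n + j := ⟨m - n, by omega⟩
    have e : ((k N : ℤ) + b - n).toNat = j := by omega
    have h1 := H.near_transfer hnear.le
    have h2 := H.div_pow_le_self' (by linarith : 0 ≤ 2 * (ε / 4)) n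
    rw [e, Real.dist_eq, sub_zero, abs_sub_comm]
    linarith
  simpa using hdiff.add hhy

/-- there is `b : ℤ` with `h = σ̂^{-b}` on the set of folding points. -/
theorem statement1 (s : ℝ) (hs1 : Real.sqrt 2 < s) (hs2 : s < 2)
    (hnr : (1 : ℝ) / 2 ∉ omegaSet (tent s) (1 / 2))
    (h : invLim s ≃ₜ invLim s) :
    ∃ b : ℤ, ∀ x ∈ foldingPts s, h x = shiftZ s hs1 hs2 (-b) x := by
  obtain ⟨d, H⟩ := exists_hyp s hs1 hs2 hnr
  obtain ⟨b, hb⟩ := main_limit H h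
  refine ⟨-b, fun x hx => ?_⟩
  obtain ⟨k, hkt, hc, hl⟩ := hb x hx
  apply Subtype.ext
  funext n
  rw [neg_neg]
  unfold shiftZ
  split_ifs with hb0
  · rw [shiftFwd_iter]
    refine tendsto_nhds_unique (hl n) ?_
    have hTc : Continuous ((tent s)^[b.toNat]) := by
      apply Continuous.iterate
      unfold tent
      fun_prop
    refine ((hTc.tendsto _).comp (hc n)).congr' ?_
    filter_upwards [hkt.eventually_ge_atTop n] with N hN
    obtain ⟨j, hj⟩ := Nat.exists_eq_add_of_le hN
    simp only [Function.comp_apply]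
    rw [hj, GG_turn H, ← iterate_add_apply]
    congr 1
    congr 1
    omega
  · rw [shiftInv_iter]
    refine tendsto_nhds_unique (hl n) ?_
    refine (hc _).congr' ?_
    filter_upwards [hkt.eventually_ge_atTop (n + (-b).toNat)] with N hN
    obtain ⟨j, hj⟩ := Nat.exists_eq_add_of_le hN
    rw [hj, GG_turn H]
    congr 1
    congr 1
    omega
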